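/- arXiv:2505.15902 — 2 statements merged into one kernel-verified Lean document; each statement's English description precedes it below -/
import Mathlib

section
/- Let (𝒳, μ) be a probability space and (Ω, ρ) a probability space. Let φ₁, φ₂ : 𝒳 × Ω → ℝ be measurable with |φ₁(x,w)| ≤ 1 and |φ₂(x,w)| ≤ 1 for all (x,w); let C > 0 and let β₁, β₂ : Ω → ℝ be measurable with |β₁(w)| ≤ C and |β₂(w)| ≤ C for all w. Define f*(x) = ∫_Ω [β₁(w) φ₁(x,w) + β₂(w) φ₂(x,w)] dρ(w). Let w₁,…,w_D be drawn i.i.d. from ρ. Then for any δ > 0, with probability at least 1 − δ over the draw of (w₁,…,w_D), there exist coefficients a₁,…,a_D and b₁,…,b_D with |a_j| ≤ C/D and |b_j| ≤ C/D (indeed a_j = β₁(w_j)/D, b_j = β₂(w_j)/D) such that the function f̂(x) = Σ_{j=1}^D [a_j φ₁(x, w_j) + b_j φ₂(x, w_j)] satisfies ( ∫_𝒳 (f̂(x) − f*(x))² dμ(x) )^{1/2} ≤ (2C/√D) · (1 + √(2 log(1/δ))). -/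
open MeasureTheory

namespace ProbabilityTheory

open scoped NNReal

/-- A function on a product changing by at most `c i` in its `i`-th coordinate varies by at most
`∑ i, c i`. -/
lemma abs_sub_le_sum_of_bounded_differences {ι : Type*} [Fintype ι] [DecidableEq ι]
    {E : ι → Type*} {F : (∀ i, E i) → ℝ} {c : ι → ℝ}
    (hF : ∀ w i v, |F (Function.update w i v) - F w| ≤ c i) (w w' : ∀ i, E i) :
    |F w - F w'| ≤ ∑ i, c i := by
  have key (s : Finset ι) : |F (s.piecewise w w') - F w'| ≤ ∑ i ∈ s, c i := by
    induction s using Finset.induction_on with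
    | empty => simp
    | insert j s hj ih =>
      rw [Finset.piecewise_insert, Finset.sum_insert hj]
      exact (abs_sub_le _ (F (s.piecewise w w')) _).trans (add_le_add (hF _ _ _) ih)
  simpa using key Finset.univ

/-- A function whose values differ by at most `c` is, once centered, sub-Gaussian with parameter
`(c / 2) ^ 2`. -/
lemma hasSubgaussianMGF_of_abs_sub_le {α : Type*} [MeasurableSpace α] {μ : Measure α}
    [IsProbabilityMeasure μ] {g : α → ℝ} {c : ℝ≥0} (hg : AEMeasurable g μ)
    (hc : ∀ a a', |g a - g a'| ≤ c) :
    HasSubgaussianMGF (fun a ↦ g a - μ[g]) ((c / 2) ^ 2) μ := by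
  have : Nonempty α := nonempty_of_isProbabilityMeasure μ
  have hbdd : BddBelow (Set.range g) := by
    obtain ⟨a₀⟩ := this
    refine ⟨g a₀ - c, ?_⟩
    rintro _ ⟨a, rfl⟩
    linarith [(abs_le.1 (hc a a₀)).1]
  have hmem (a : α) : g a ∈ Set.Icc (⨅ a, g a) ((⨅ a, g a) + c) := by
    refine ⟨ciInf_le hbdd a, ?_⟩
    have : g a - c ≤ ⨅ a, g a := le_ciInf fun a' ↦ by linarith [(abs_le.1 (hc a a')).2]
    linarith
  have h := hasSubgaussianMGF_of_mem_Icc hg (ae_of_all μ hmem)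
  have hcc : ‖(⨅ a, g a) + c - ⨅ a, g a‖₊ = c := by
    rw [add_sub_cancel_left]
    exact Real.nnnorm_of_nonneg c.2
  rwa [hcc] at h

/-- If the sections of `F` are sub-Gaussian around their means, and these means are sub-Gaussian
around their own mean, then `F` is sub-Gaussian around its mean. -/
lemma hasSubgaussianMGF_sub_integral_prod {α β : Type*} [MeasurableSpace α] [MeasurableSpace β]
    {μ : Measure α} {ν : Measure β} [IsProbabilityMeasure μ] [IsProbabilityMeasure ν]
    {F : α × β → ℝ} (hFm : Measurable F) {M : ℝ} (hM : ∀ p, |F p| ≤ M) {c₁ c₂ : ℝ≥0}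
    (h₁ : HasSubgaussianMGF (fun a ↦ ν[fun b ↦ F (a, b)] - ∫ a, ν[fun b ↦ F (a, b)] ∂μ) c₁ μ)
    (h₂ : ∀ a, HasSubgaussianMGF (fun b ↦ F (a, b) - ν[fun b ↦ F (a, b)]) c₂ ν) :
    HasSubgaussianMGF (fun p ↦ F p - (μ.prod ν)[F]) (c₁ + c₂) (μ.prod ν) := by
  have hFi : Integrable F (μ.prod ν) :=
    .of_bound hFm.aestronglyMeasurable M (ae_of_all _ hM)
  have hint (t : ℝ) : Integrable (fun p ↦ Real.exp (t * (F p - (μ.prod ν)[F]))) (μ.prod ν) := by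
    refine .of_bound (by fun_prop) (Real.exp (|t| * (M + |(μ.prod ν)[F]|))) (ae_of_all _ fun p ↦ ?_)
    rw [Real.norm_eq_abs, Real.abs_exp, Real.exp_le_exp]
    refine (le_abs_self _).trans ?_
    rw [abs_mul]
    gcongr
    exact (abs_sub _ _).trans (by gcongr; exact hM p)
  refine ⟨hint, fun t ↦ ?_⟩
  rw [mgf, integral_prod _ (hint t)]
  have hsplit (a : α) : ∫ b, Real.exp (t * (F (a, b) - (μ.prod ν)[F])) ∂ν ≤
      Real.exp (c₂ * t ^ 2 / 2) *
        Real.exp (t * (ν[fun b ↦ F (a, b)] - ∫ a, ν[fun b ↦ F (a, b)] ∂μ)) := by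
    rw [← integral_prod _ hFi]
    calc ∫ b, Real.exp (t * (F (a, b) - (μ.prod ν)[F])) ∂ν
        = (∫ b, Real.exp (t * (F (a, b) - ν[fun b ↦ F (a, b)])) ∂ν) *
            Real.exp (t * (ν[fun b ↦ F (a, b)] - (μ.prod ν)[F])) := by
          rw [← integral_mul_const]
          congr with b
          rw [← Real.exp_add]
          ring_nf
      _ ≤ _ := by
          gcongr
          exact (h₂ a).mgf_le t
  calc ∫ a, ∫ b, Real.exp (t * (F (a, b) - (μ.prod ν)[F])) ∂ν ∂μ
      ≤ ∫ a, Real.exp (c₂ * t ^ 2 / 2) *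
          Real.exp (t * (ν[fun b ↦ F (a, b)] - ∫ a, ν[fun b ↦ F (a, b)] ∂μ)) ∂μ :=
        integral_mono (hint t).integral_prod_left ((h₁.integrable_exp_mul t).const_mul _) hsplit
    _ ≤ Real.exp (c₂ * t ^ 2 / 2) * Real.exp (c₁ * t ^ 2 / 2) := by
        rw [integral_const_mul]
        gcongr
        exact h₁.mgf_le t
    _ = Real.exp (↑(c₁ + c₂) * t ^ 2 / 2) := by
        rw [← Real.exp_add]
        push_cast
        ring_nf

/-- **McDiarmid's inequality**, moment generating function form. -/
theorem hasSubgaussianMGF_of_bounded_differences {n : ℕ} {E : Fin n → Type*}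
    [∀ i, MeasurableSpace (E i)] (μ : ∀ i, Measure (E i)) [∀ i, IsProbabilityMeasure (μ i)]
    {F : (∀ i, E i) → ℝ} (hFm : Measurable F) {c : Fin n → ℝ≥0}
    (hF : ∀ w i v, |F (Function.update w i v) - F w| ≤ c i) :
    HasSubgaussianMGF (fun w ↦ F w - (Measure.pi μ)[F]) (∑ i, (c i / 2) ^ 2) (Measure.pi μ) := by
  induction n with
  | zero =>
    have hF0 (w : ∀ i, E i) : F w = F (fun i ↦ i.elim0) := congrArg F (Subsingleton.elim _ _)
    have : F = fun _ ↦ F (fun i ↦ i.elim0) := funext hF0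
    rw [this]
    simp
  | succ n ih =>
    let e := MeasurableEquiv.piFinSuccAbove E 0
    have he : MeasurePreserving e (Measure.pi μ)
        ((μ 0).prod (Measure.pi fun j ↦ μ (Fin.succAbove 0 j))) :=
      measurePreserving_piFinSuccAbove μ 0
    have he₀ (a a' : E 0) (b : ∀ j : Fin n, E (Fin.succAbove 0 j)) :
        Function.update (e.symm (a', b)) 0 a = e.symm (a, b) :=
      Fin.update_insertNth _ _ _ _
    have hes (a : E 0) (b : ∀ j : Fin n, E (Fin.succAbove 0 j)) (j : Fin n)
        (v : E (Fin.succAbove 0 j)) :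
        Function.update (e.symm (a, b)) (Fin.succAbove 0 j) v =
          e.symm (a, Function.update b j v) :=
      (Fin.insertNth_update _ _ _ _ _).symm
    let G : E 0 × (∀ j : Fin n, E (Fin.succAbove 0 j)) → ℝ := fun p ↦ F (e.symm p)
    have hGm : Measurable G := hFm.comp e.symm.measurable
    obtain ⟨w₀⟩ : Nonempty (∀ i, E i) := nonempty_of_isProbabilityMeasure (Measure.pi μ)
    have hM (w : ∀ i, E i) : |F w| ≤ |F w₀| + ∑ i, (c i : ℝ) := by
      have h := abs_sub_le_sum_of_bounded_differences hF w w₀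
      have := abs_sub_abs_le_abs_sub (F w) (F w₀)
      linarith
    have hGi (a : E 0) : Integrable (fun b ↦ G (a, b))
        (Measure.pi fun j ↦ μ (Fin.succAbove 0 j)) :=
      .of_bound (hGm.comp measurable_prodMk_left).aestronglyMeasurable _ (ae_of_all _ fun b ↦ hM _)
    have hG₀ (a a' : E 0) (b : ∀ j : Fin n, E (Fin.succAbove 0 j)) :
        |G (a, b) - G (a', b)| ≤ c 0 := by
      simpa only [he₀] using hF (e.symm (a', b)) 0 a
    have h₁ := hasSubgaussianMGF_of_abs_sub_le (μ := μ 0) (c := c 0)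
      (g := fun a ↦ ∫ b, G (a, b) ∂(Measure.pi fun j ↦ μ (Fin.succAbove 0 j)))
      hGm.stronglyMeasurable.integral_prod_right.measurable.aemeasurable fun a a' ↦ by
        rw [← integral_sub (hGi a) (hGi a')]
        have h := norm_integral_le_of_norm_le_const (f := fun b ↦ G (a, b) - G (a', b))
          (ae_of_all (Measure.pi fun j ↦ μ (Fin.succAbove 0 j)) (hG₀ a a'))
        rwa [probReal_univ, mul_one] at h
    have h₂ (a : E 0) := ih (fun j ↦ μ (Fin.succAbove 0 j)) (F := fun b ↦ G (a, b))
      (hGm.comp measurable_prodMk_left) (c := fun j ↦ c (Fin.succAbove 0 j)) fun b j v ↦ by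
        simpa only [hes] using hF (e.symm (a, b)) (Fin.succAbove 0 j) v
    have h := hasSubgaussianMGF_sub_integral_prod hGm (fun p ↦ hM _) h₁ h₂
    rw [← he.integral_comp', ← he.map_eq, ← Fin.sum_univ_succAbove (fun i ↦ (c i / 2) ^ 2)] at h
    simpa only [Function.comp_def, G, e.symm_apply_apply] using h.of_map he.measurable.aemeasurable

/-- The reverse triangle inequality in `L²`, for the root mean square. -/
lemma abs_sqrt_integral_sq_sub_le {α : Type*} [MeasurableSpace α] {μ : Measure α}
    {u v : α → ℝ} (hu : MemLp u 2 μ) (hv : MemLp v 2 μ) :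
    |√(∫ x, u x ^ 2 ∂μ) - √(∫ x, v x ^ 2 ∂μ)| ≤ √(∫ x, (u x - v x) ^ 2 ∂μ) := by
  have norm_eq {f : α → ℝ} (hf : MemLp f 2 μ) : ‖hf.toLp f‖ = √(∫ x, f x ^ 2 ∂μ) := by
    rw [Lp.norm_toLp, hf.eLpNorm_eq_integral_rpow_norm two_ne_zero ENNReal.ofNat_ne_top,
      ENNReal.toReal_ofReal (by positivity), Real.sqrt_eq_rpow]
    simp
  have h := abs_norm_sub_norm_le (hu.toLp u) (hv.toLp v)
  rwa [← MemLp.toLp_sub, norm_eq, norm_eq, norm_eq] at h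

/-- The root mean square of a function bounded by `c` is at most `c`. -/
lemma sqrt_integral_sq_le {α : Type*} [MeasurableSpace α] {μ : Measure α}
    [IsProbabilityMeasure μ] {u : α → ℝ} {c : ℝ} (hc : 0 ≤ c) (hu : ∀ x, |u x| ≤ c) :
    √(∫ x, u x ^ 2 ∂μ) ≤ c := by
  refine Real.sqrt_le_iff.2 ⟨hc, ?_⟩
  have h := norm_integral_le_of_norm_le_const (μ := μ) (f := fun x ↦ u x ^ 2) (C := c ^ 2)
    (ae_of_all _ fun x ↦ by
      rw [Real.norm_eq_abs, abs_pow]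
      exact pow_le_pow_left₀ (abs_nonneg _) (hu x) 2)
  rw [probReal_univ, mul_one] at h
  exact (le_abs_self _).trans h

/-- The mean of a square-integrable function is at most its root mean square. -/
lemma integral_le_sqrt_integral_sq {α : Type*} [MeasurableSpace α] {μ : Measure α}
    [IsProbabilityMeasure μ] {u : α → ℝ} (hu : MemLp u 2 μ) :
    ∫ x, u x ∂μ ≤ √(∫ x, u x ^ 2 ∂μ) := by
  refine Real.le_sqrt_of_sq_le ?_
  have h := variance_eq_sub hu
  have := variance_nonneg u μ
  simp only [Pi.pow_apply] at h
  linarith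

/-- The mean squared error of an empirical mean of `n` samples bounded by `B` is at most
`B ^ 2 / n`. -/
lemma integral_sq_empirical_mean_sub_le {W : Type*} [MeasurableSpace W] {ρ : Measure W}
    [IsProbabilityMeasure ρ] {h : W → ℝ} (hm : Measurable h) {B : ℝ} (hB : ∀ w, |h w| ≤ B)
    {n : ℕ} (hn : 0 < n) :
    ∫ w : Fin n → W, ((∑ j, h (w j)) / n - ∫ w', h w' ∂ρ) ^ 2 ∂(Measure.pi fun _ ↦ ρ) ≤
      B ^ 2 / n := by
  have hn' : (0 : ℝ) < n := Nat.cast_pos.2 hn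
  have hL : MemLp h 2 ρ := .of_bound hm.aestronglyMeasurable B (ae_of_all _ hB)
  have hint (j : Fin n) :
      Integrable (fun w : Fin n → W ↦ h (w j)) (Measure.pi fun _ ↦ ρ) :=
    .of_bound (hm.comp (measurable_pi_apply j)).aestronglyMeasurable B
      (ae_of_all _ fun w ↦ hB (w j))
  have hmean : ∫ w : Fin n → W, ∑ j, h (w j) ∂(Measure.pi fun _ ↦ ρ) = n * ∫ w', h w' ∂ρ := by
    rw [integral_finsetSum _ fun j _ ↦ hint j]
    simp [integral_comp_eval (μ := fun _ : Fin n ↦ ρ) hm.aestronglyMeasurable]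
  have hvar := variance_sum_pi (μ := fun _ : Fin n ↦ ρ) (X := fun _ ↦ h) fun _ ↦ hL
  rw [variance_eq_integral (by fun_prop)] at hvar
  simp only [Finset.sum_apply, hmean, Finset.sum_const, Finset.card_univ, Fintype.card_fin,
    nsmul_eq_mul] at hvar
  have hle : Var[h; ρ] ≤ B ^ 2 := by
    have := variance_le_sq_of_bounded (ae_of_all ρ fun w ↦ abs_le.1 (hB w)) hm.aemeasurable
    linarith [show ((B - -B) / 2) ^ 2 = B ^ 2 by ring]
  calc ∫ w : Fin n → W, ((∑ j, h (w j)) / n - ∫ w', h w' ∂ρ) ^ 2 ∂(Measure.pi fun _ ↦ ρ)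
      = (∫ w : Fin n → W, (∑ j, h (w j) - n * ∫ w', h w' ∂ρ) ^ 2 ∂(Measure.pi fun _ ↦ ρ)) /
          n ^ 2 := by
        rw [← integral_div]
        congr with w
        field_simp
    _ = Var[h; ρ] / n := by
        rw [hvar]
        field_simp
    _ ≤ B ^ 2 / n := by gcongr

/-- An empirical mean of `n` random features bounded by `B` is, with probability at least `1 - δ`,
within `B / √n * (1 + √(2 * log (1 / δ)))` of the expected feature in `L²(μ)`. -/
theorem ofReal_one_sub_le_pi_sqrt_integral_sq_le {X W : Type*} [MeasurableSpace X]
    [MeasurableSpace W] {μ : Measure X} {ρ : Measure W} [IsProbabilityMeasure μ]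
    [IsProbabilityMeasure ρ] {h : X → W → ℝ} (hm : Measurable (Function.uncurry h)) {B : ℝ}
    (hB₀ : 0 < B) (hB : ∀ x w, |h x w| ≤ B) {n : ℕ} (hn : 0 < n) {δ : ℝ} (hδ : 0 < δ) :
    ENNReal.ofReal (1 - δ) ≤ (Measure.pi fun _ : Fin n ↦ ρ)
      {w | √(∫ x, ((∑ j, h x (w j)) / n - ∫ w', h x w' ∂ρ) ^ 2 ∂μ) ≤
        B / √n * (1 + √(2 * Real.log (1 / δ)))} := by
  rcases le_or_gt 1 δ with hδ₁ | hδ₁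
  · simp [ENNReal.ofReal_of_nonpos (sub_nonpos.2 hδ₁)]
  have hn' : (0 : ℝ) < n := Nat.cast_pos.2 hn
  let P : Measure (Fin n → W) := Measure.pi fun _ ↦ ρ
  let u : (Fin n → W) → X → ℝ := fun w x ↦ (∑ j, h x (w j)) / n - ∫ w', h x w' ∂ρ
  let F : (Fin n → W) → ℝ := fun w ↦ √(∫ x, u w x ^ 2 ∂μ)
  have hum : Measurable (Function.uncurry u) := by
    have h₁ : Measurable fun x ↦ ∫ w', h x w' ∂ρ :=
      hm.stronglyMeasurable.integral_prod_right.measurable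
    have h₂ (j : Fin n) : Measurable fun p : (Fin n → W) × X ↦ h p.2 (p.1 j) :=
      hm.comp (measurable_snd.prodMk ((measurable_pi_apply j).comp measurable_fst))
    exact ((Finset.measurable_sum _ fun j _ ↦ h₂ j).div_const _).sub (h₁.comp measurable_snd)
  have hub (w : Fin n → W) (x : X) : |u w x| ≤ 2 * B := by
    have h₁ : |(∑ j, h x (w j)) / n| ≤ B := by
      rw [abs_div, Nat.abs_cast, div_le_iff₀ hn']
      refine (Finset.abs_sum_le_sum_abs _ _).trans ((Finset.sum_le_sum fun j _ ↦ hB x _).trans ?_)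
      simp [mul_comm]
    have h₂ : |∫ w', h x w' ∂ρ| ≤ B := by
      simpa using norm_integral_le_of_norm_le_const (f := h x) (ae_of_all ρ (hB x))
    exact (abs_sub _ _).trans (by linarith)
  have huL (w : Fin n → W) : MemLp (u w) 2 μ :=
    .of_bound (hum.comp measurable_prodMk_left).aestronglyMeasurable _ (ae_of_all _ (hub w))
  have hFm : Measurable F :=
    (hum.pow_const 2).stronglyMeasurable.integral_prod_right.measurable.sqrt
  have hFL : MemLp F 2 P :=
    .of_bound hFm.aestronglyMeasurable (2 * B) (ae_of_all _ fun w ↦ by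
      rw [Real.norm_of_nonneg (Real.sqrt_nonneg _)]
      exact sqrt_integral_sq_le (by positivity) (hub w))
  let c : ℝ≥0 := ⟨2 * B / n, by positivity⟩
  have hFd (w : Fin n → W) (i : Fin n) (v : W) : |F (Function.update w i v) - F w| ≤ c := by
    refine (abs_sqrt_integral_sq_sub_le (huL _) (huL _)).trans
      (sqrt_integral_sq_le c.2 fun x ↦ ?_)
    have hsum : u (Function.update w i v) x - u w x = (h x v - h x (w i)) / n := by
      have h₁ : ∑ j, h x (Function.update w i v j) - ∑ j, h x (w j) = h x v - h x (w i) := by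
        rw [← Finset.sum_sub_distrib, Finset.sum_eq_single i (fun j _ hj ↦ by simp [hj]) (by simp)]
        simp
      rw [← h₁]
      simp only [u]
      ring
    rw [hsum, abs_div, Nat.abs_cast]
    change _ ≤ 2 * B / n
    gcongr
    exact (abs_sub _ _).trans (by linarith [hB x v, hB x (w i)])
  have hmean : P[F] ≤ B / √n := by
    refine (integral_le_sqrt_integral_sq hFL).trans ?_
    rw [← Real.sqrt_sq hB₀.le, ← Real.sqrt_div (sq_nonneg B)]
    refine Real.sqrt_le_sqrt ?_
    have hsq (w : Fin n → W) : F w ^ 2 = ∫ x, u w x ^ 2 ∂μ :=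
      Real.sq_sqrt (integral_nonneg fun x ↦ sq_nonneg _)
    simp only [hsq]
    have hu2 : Integrable (Function.uncurry fun w x ↦ u w x ^ 2) (P.prod μ) :=
      .of_bound (hum.pow_const 2).aestronglyMeasurable ((2 * B) ^ 2) (ae_of_all _ fun p ↦ by
        simp only [Function.uncurry, Real.norm_eq_abs, abs_pow]
        exact pow_le_pow_left₀ (abs_nonneg _) (hub _ _) 2)
    rw [integral_integral_swap hu2]
    refine (integral_mono hu2.integral_prod_right (integrable_const _) fun x ↦
      integral_sq_empirical_mean_sub_le (hm.comp measurable_prodMk_left) (hB x) hn).trans ?_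
    simp
  have hlog : 0 < Real.log (1 / δ) := Real.log_pos (by rwa [one_lt_div hδ])
  set t : ℝ := B / √n * √(2 * Real.log (1 / δ)) with ht
  have htail : P.real {w | t ≤ F w - P[F]} ≤ δ := by
    refine ((hasSubgaussianMGF_of_bounded_differences (fun _ ↦ ρ) hFm hFd).measure_ge_le
      (by positivity)).trans_eq ?_
    have hc : ((∑ _ : Fin n, (c / 2) ^ 2 : ℝ≥0) : ℝ) = B ^ 2 / n := by
      have : (c : ℝ) = 2 * B / n := rfl
      simp only [Finset.sum_const, Finset.card_univ, Fintype.card_fin, nsmul_eq_mul]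
      push_cast
      rw [this]
      field_simp
    have ht2 : t ^ 2 = B ^ 2 / n * (2 * Real.log (1 / δ)) := by
      rw [ht, mul_pow, div_pow, Real.sq_sqrt hn'.le, Real.sq_sqrt (by positivity)]
    have hexp : -t ^ 2 / (2 * (B ^ 2 / n)) = Real.log δ := by
      rw [ht2, one_div, Real.log_inv]
      field_simp
    rw [hc, hexp, Real.exp_log hδ]
  have hFms : MeasurableSet {w | t ≤ F w - P[F]} := measurableSet_le (by fun_prop) (by fun_prop)
  calc ENNReal.ofReal (1 - δ) ≤ ENNReal.ofReal (P.real {w | t ≤ F w - P[F]}ᶜ) := by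
        rw [probReal_compl_eq_one_sub hFms]
        gcongr
    _ = P {w | t ≤ F w - P[F]}ᶜ := ofReal_measureReal
    _ ≤ _ := measure_mono fun w hw ↦ by
        simp only [Set.mem_compl_iff, Set.mem_ofPred_eq, not_le] at hw
        change F w ≤ B / √n * (1 + √(2 * Real.log (1 / δ)))
        rw [mul_add, mul_one]
        linarith

end ProbabilityTheory

/-- **Two-feature random features approximation lemma.**  Let `f*(x) = ∫ β₁(w)φ₁(x,w) +
β₂(w)φ₂(x,w) dρ(w)` with `|φᵢ| ≤ 1` and `|βᵢ| ≤ C`.  Drawing `w₁, …, w_D` i.i.d. from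
`ρ`, with probability at least `1 − δ` there are coefficients `a_j, b_j` with
`|a_j|, |b_j| ≤ C/D` such that `f̂(x) = ∑_j a_j φ₁(x,w_j) + b_j φ₂(x,w_j)` satisfies
`‖f̂ − f*‖_{L²(μ)} ≤ (2C/√D)(1 + √(2 log(1/δ)))`. -/
theorem random_features_approximation
    {X W : Type*} [MeasurableSpace X] [MeasurableSpace W]
    (μ : Measure X) (ρ : Measure W) [IsProbabilityMeasure μ] [IsProbabilityMeasure ρ]
    (φ₁ φ₂ : X → W → ℝ)
    (hφ₁m : Measurable (Function.uncurry φ₁)) (hφ₂m : Measurable (Function.uncurry φ₂))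
    (hφ₁b : ∀ x w, |φ₁ x w| ≤ 1) (hφ₂b : ∀ x w, |φ₂ x w| ≤ 1)
    (C : ℝ) (hC : 0 < C)
    (β₁ β₂ : W → ℝ) (hβ₁m : Measurable β₁) (hβ₂m : Measurable β₂)
    (hβ₁b : ∀ w, |β₁ w| ≤ C) (hβ₂b : ∀ w, |β₂ w| ≤ C)
    (D : ℕ) (hD : 0 < D) (δ : ℝ) (hδ : 0 < δ) :
    ENNReal.ofReal (1 - δ) ≤
      (Measure.pi fun _ : Fin D => ρ)
        {w : Fin D → W |
          ∃ a b : Fin D → ℝ, (∀ j, |a j| ≤ C / D) ∧ (∀ j, |b j| ≤ C / D) ∧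
            Real.sqrt (∫ x,
                ((∑ j, (a j * φ₁ x (w j) + b j * φ₂ x (w j))) -
                  ∫ w', (β₁ w' * φ₁ x w' + β₂ w' * φ₂ x w') ∂ρ) ^ 2 ∂μ)
              ≤ (2 * C / Real.sqrt D) * (1 + Real.sqrt (2 * Real.log (1 / δ))) } := by
  have hm : Measurable (Function.uncurry fun x w ↦ β₁ w * φ₁ x w + β₂ w * φ₂ x w) :=
    ((hβ₁m.comp measurable_snd).mul hφ₁m).add ((hβ₂m.comp measurable_snd).mul hφ₂m)
  have hprod {β φ : ℝ} (hβ : |β| ≤ C) (hφ : |φ| ≤ 1) : |β * φ| ≤ C := by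
    rw [abs_mul]
    exact (mul_le_of_le_one_right (abs_nonneg _) hφ).trans hβ
  have hb (x : X) (w : W) : |β₁ w * φ₁ x w + β₂ w * φ₂ x w| ≤ 2 * C :=
    (abs_add_le _ _).trans (by
      linarith [hprod (hβ₁b w) (hφ₁b x w), hprod (hβ₂b w) (hφ₂b x w)])
  have hcoef {β : W → ℝ} (hβ : ∀ w, |β w| ≤ C) (w : W) : |β w / D| ≤ C / D := by
    rw [abs_div, Nat.abs_cast]
    gcongr
    exact hβ w
  refine (ProbabilityTheory.ofReal_one_sub_le_pi_sqrt_integral_sq_le (μ := μ) (ρ := ρ) hm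
    (by positivity) hb hD hδ).trans (measure_mono fun w hw ↦ ?_)
  refine ⟨fun j ↦ β₁ (w j) / D, fun j ↦ β₂ (w j) / D, fun j ↦ hcoef hβ₁b _,
    fun j ↦ hcoef hβ₂b _, ?_⟩
  simpa only [Set.mem_ofPred_eq, Finset.sum_div, add_div, mul_div_right_comm] using hw
end

section
/- Let Ω ⊆ ℝ^d be a finite set of frequency vectors and p a probability mass function on Ω. Let Π be a probability distribution on ℝ^d × {−1,1}; for f : ℝ^d → ℝ define the hinge true risk R[f] = E_{(X,Y)∼Π}[max(0, 1 − Y f(X))]. Let C > 0, λ ≥ 0, and define the class 𝒢_{p,C} = { f(x) = Σ_{ω∈Ω} [α(ω) cos(ω·x) + β(ω) sin(ω·x)] : |α(ω)| ≤ C p(ω) and |β(ω)| ≤ C p(ω) for all ω ∈ Ω }. Draw training data (x₁,y₁),…,(x_m,y_m) i.i.d. from Π and frequencies ω₁,…,ω_D i.i.d. from p, all independent; set z(x) = (cos(ω₁·x), sin(ω₁·x), …, cos(ω_D·x), sin(ω_D·x)) ∈ ℝ^{2D}, and let f̂(x) = β̂ᵀ z(x) where β̂ is any minimizer of (λ/2)‖β‖₂²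 + (1/m) Σ_{i=1}^m max(0, 1 − y_i βᵀ z(x_i)) over {β ∈ ℝ^{2D} : ‖β‖_∞ ≤ C/D}. Then there exists a universal constant κ > 0, independent of d, m, D, C, λ, δ, p and Π, such that for every δ ∈ (0,1), with probability at least 1 − 2δ over the training data and the frequency samples, R[f̂] − min_{f ∈ 𝒢_{p,C}} R[f] ≤ κ · ( (1/√m + 1/√D) · C · √(log(1/δ)) + λ C²/D ). -/
open MeasureTheory
open scoped InnerProductSpace

/-- Hinge true risk of a decision function `f` under a data distribution `Π` on
`ℝ^d × ℝ` (labels in `{−1, +1}`). -/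
noncomputable def hingeRisk {d : ℕ} (Pi : Measure (EuclideanSpace ℝ (Fin d) × ℝ))
    (f : EuclideanSpace ℝ (Fin d) → ℝ) : ℝ :=
  ∫ z, max 0 (1 - z.2 * f z.1) ∂Pi

/-- The random-Fourier-feature decision function `x ↦ βᵀ z(x)` with
`z(x) = (cos(ω'₁·x), sin(ω'₁·x), …, cos(ω'_D·x), sin(ω'_D·x))`, the frequencies
`ω'_j = W j` and coefficients `β = (β₁, β₂)` (cosine and sine parts). -/
noncomputable def rffFun {d D : ℕ} (W : Fin D → EuclideanSpace ℝ (Fin d))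
    (β : (Fin D → ℝ) × (Fin D → ℝ)) (x : EuclideanSpace ℝ (Fin d)) : ℝ :=
  ∑ j, (β.1 j * Real.cos ⟪W j, x⟫_ℝ + β.2 j * Real.sin ⟪W j, x⟫_ℝ)

/-- Box constraint `‖β‖_∞ ≤ C/D` on the RFF coefficients. -/
def inBox {D : ℕ} (C : ℝ) (β : (Fin D → ℝ) × (Fin D → ℝ)) : Prop :=
  ∀ j, |β.1 j| ≤ C / D ∧ |β.2 j| ≤ C / D

/-- Regularized empirical hinge risk `(λ/2)‖β‖₂² + (1/m) ∑ᵢ max(0, 1 − yᵢ βᵀ z(xᵢ))`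
for the RFF-SVM with sampled frequencies `W` and training set `S`. -/
noncomputable def empObj {d D m : ℕ} (lam : ℝ)
    (W : Fin D → EuclideanSpace ℝ (Fin d))
    (S : Fin m → EuclideanSpace ℝ (Fin d) × ℝ)
    (β : (Fin D → ℝ) × (Fin D → ℝ)) : ℝ :=
  lam / 2 * (∑ j, ((β.1 j) ^ 2 + (β.2 j) ^ 2)) +
    (1 / m : ℝ) * ∑ i, max 0 (1 - (S i).2 * rffFun W β (S i).1)

lemma exp_add_exp_le_of_le_max {a b a' b' : ℝ} (hsum : a + b ≤ a' + b')
    (ha : a ≤ max a' b') (hb : b ≤ max a' b') :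
    Real.exp a + Real.exp b ≤ Real.exp a' + Real.exp b' := by
  wlog hab : b ≤ a generalizing a b
  · rw [add_comm (Real.exp a)]
    exact this (by linarith) hb ha (le_of_not_ge hab)
  wlog hab' : b' ≤ a' generalizing a' b'
  · rw [add_comm (Real.exp a')]
    exact this (by linarith) (by rwa [max_comm]) (by rwa [max_comm]) (le_of_not_ge hab')
  rw [max_eq_left hab'] at ha hb
  have h1 : Real.exp a * (a' - a) ≤ Real.exp a' - Real.exp a := by
    have := Real.add_one_le_exp (a' - a)
    have h2 : Real.exp a' = Real.exp a * Real.exp (a' - a) := by rw [← Real.exp_add]; ring_nf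
    nlinarith [Real.exp_pos a]
  have h3 : Real.exp b - Real.exp b' ≤ Real.exp b * (b - b') := by
    have := Real.add_one_le_exp (b' - b)
    have h2 : Real.exp b' = Real.exp b * Real.exp (b' - b) := by rw [← Real.exp_add]; ring_nf
    nlinarith [Real.exp_pos b]
  have h4 : Real.exp b * (b - b') ≤ Real.exp b * (a' - a) :=
    mul_le_mul_of_nonneg_left (by linarith) (Real.exp_pos b).le
  have h5 : Real.exp b * (a' - a) ≤ Real.exp a * (a' - a) :=
    mul_le_mul_of_nonneg_right (Real.exp_le_exp.2 hab) (by linarith)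
  linarith

/-- The sign `±1` encoded by a Boolean. -/
def boolSign (b : Bool) : ℝ := if b then 1 else -1

lemma abs_boolSign (b : Bool) : |boolSign b| = 1 := by cases b <;> simp [boolSign]

lemma boolSign_not (b : Bool) : boolSign (!b) = -boolSign b := by cases b <;> simp [boolSign]

section Contraction

variable {ι κ : Type*} [Fintype ι] [Nonempty ι] [Fintype κ] [DecidableEq κ]

/-- The supremum of a real function on a nonempty finite type. -/
noncomputable def finSup (f : ι → ℝ) : ℝ := Finset.univ.sup' Finset.univ_nonempty f

lemma le_finSup (f : ι → ℝ) (i : ι) : f i ≤ finSup f :=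
  Finset.le_sup' f (Finset.mem_univ i)

lemma exists_eq_finSup (f : ι → ℝ) : ∃ i, finSup f = f i := by
  obtain ⟨i, -, hi⟩ := Finset.exists_mem_eq_sup' Finset.univ_nonempty f
  exact ⟨i, hi⟩

lemma finSup_le {f : ι → ℝ} {a : ℝ} (h : ∀ i, f i ≤ a) : finSup f ≤ a :=
  Finset.sup'_le _ _ fun i _ => h i

lemma exp_finSup_contraction (u x y : ι → ℝ) (hxy : ∀ i j, |y i - y j| ≤ |x i - x j|)
    (hy : ∀ i, |y i| ≤ |x i|) :
    Real.exp (finSup fun i => u i + y i) + Real.exp (finSup fun i => u i - y i) ≤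
      Real.exp (finSup fun i => u i + x i) + Real.exp (finSup fun i => u i - x i) := by
  obtain ⟨i, hi⟩ := exists_eq_finSup fun i => u i + y i
  obtain ⟨j, hj⟩ := exists_eq_finSup fun i => u i - y i
  have h1 := le_finSup (fun i => u i + x i) i
  have h2 := le_finSup (fun i => u i + x i) j
  have h3 := le_finSup (fun i => u i - x i) i
  have h4 := le_finSup (fun i => u i - x i) j
  apply exp_add_exp_le_of_le_max
  · rw [hi, hj]
    have := (le_abs_self _).trans (hxy i j)
    rcases abs_cases (x i - x j) with h | h <;> linarith
  · rw [hi]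
    have := (le_abs_self _).trans (hy i)
    rcases abs_cases (x i) with h | h
    · exact le_max_of_le_left (by linarith)
    · exact le_max_of_le_right (by linarith)
  · rw [hj]
    have := (neg_le_abs _).trans (hy j)
    rcases abs_cases (x j) with h | h
    · exact le_max_of_le_left (by linarith)
    · exact le_max_of_le_right (by linarith)

/-- Flipping the sign at one coordinate. -/
def flipAt (a : κ) : Equiv.Perm (κ → Bool) :=
  Function.Involutive.toPerm (fun σ => Function.update σ a (!σ a)) fun σ => by
    simp

lemma sum_exp_finSup_update_le (a : κ) (x y : ι → κ → ℝ)
    (hne : ∀ i k, k ≠ a → y i k = x i k)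
    (hxy : ∀ i j, |y i a - y j a| ≤ |x i a - x j a|) (hy : ∀ i, |y i a| ≤ |x i a|) :
    ∑ σ : κ → Bool, Real.exp (finSup fun i => ∑ k, boolSign (σ k) * y i k) ≤
      ∑ σ : κ → Bool, Real.exp (finSup fun i => ∑ k, boolSign (σ k) * x i k) := by
  have key : ∀ z : ι → κ → ℝ,
      2 * ∑ σ : κ → Bool, Real.exp (finSup fun i => ∑ k, boolSign (σ k) * z i k) =
      ∑ σ : κ → Bool,
        (Real.exp (finSup fun i =>
            ∑ k ∈ Finset.univ.erase a, boolSign (σ k) * z i k + boolSign (σ a) * z i a) +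
          Real.exp (finSup fun i =>
            ∑ k ∈ Finset.univ.erase a, boolSign (σ k) * z i k - boolSign (σ a) * z i a)) := by
    intro z
    rw [two_mul, Finset.sum_add_distrib]
    congr 1
    · refine Finset.sum_congr rfl fun σ _ => ?_
      congr 2
      ext i
      rw [Finset.sum_erase_add _ _ (Finset.mem_univ a)]
    · rw [← Equiv.sum_comp (flipAt a)]
      refine Finset.sum_congr rfl fun σ _ => ?_
      congr 2
      ext i
      rw [← Finset.sum_erase_add _ _ (Finset.mem_univ a), sub_eq_add_neg]
      congr 1
      · refine Finset.sum_congr rfl fun k hk => ?_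
        simp [flipAt, Function.Involutive.toPerm, Finset.ne_of_mem_erase hk]
      · simp [flipAt, Function.Involutive.toPerm, boolSign_not]
  have : 2 * ∑ σ : κ → Bool, Real.exp (finSup fun i => ∑ k, boolSign (σ k) * y i k) ≤
      2 * ∑ σ : κ → Bool, Real.exp (finSup fun i => ∑ k, boolSign (σ k) * x i k) := by
    rw [key, key]
    refine Finset.sum_le_sum fun σ _ => ?_
    have hu : ∀ i, ∑ k ∈ Finset.univ.erase a, boolSign (σ k) * y i k =
        ∑ k ∈ Finset.univ.erase a, boolSign (σ k) * x i k := fun i =>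
      Finset.sum_congr rfl fun k hk => by rw [hne i k (Finset.ne_of_mem_erase hk)]
    simp only [hu]
    apply exp_finSup_contraction
    · intro i j
      rw [← mul_sub, ← mul_sub, abs_mul, abs_mul, abs_boolSign, one_mul, one_mul]
      exact hxy i j
    · intro i
      rw [abs_mul, abs_mul, abs_boolSign, one_mul, one_mul]
      exact hy i
  linarith

/-- The Ledoux–Talagrand contraction principle for exponential moments. -/
lemma sum_exp_finSup_contraction (x y : ι → κ → ℝ)
    (hxy : ∀ i j k, |y i k - y j k| ≤ |x i k - x j k|) (hy : ∀ i k, |y i k| ≤ |x i k|) :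
    ∑ σ : κ → Bool, Real.exp (finSup fun i => ∑ k, boolSign (σ k) * y i k) ≤
      ∑ σ : κ → Bool, Real.exp (finSup fun i => ∑ k, boolSign (σ k) * x i k) := by
  have key : ∀ s : Finset κ,
      ∑ σ : κ → Bool, Real.exp (finSup fun i => ∑ k, boolSign (σ k) * y i k) ≤
      ∑ σ : κ → Bool, Real.exp (finSup fun i =>
        ∑ k, boolSign (σ k) * if k ∈ s then x i k else y i k) := by
    intro s
    induction s using Finset.induction_on with
    | empty => simp
    | insert a s ha ih =>
      refine ih.trans (sum_exp_finSup_update_le a _ _ ?_ ?_ ?_)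
      · intro i k hk
        simp [hk]
      · intro i j
        simpa [ha] using hxy i j a
      · intro i
        simpa [ha] using hy i a
  simpa using key Finset.univ

lemma sum_exp_boolSign_le (c : κ → ℝ) :
    ∑ σ : κ → Bool, Real.exp (∑ k, boolSign (σ k) * c k) ≤
      2 ^ Fintype.card κ * Real.exp ((∑ k, c k ^ 2) / 2) := by
  have h : ∑ σ : κ → Bool, Real.exp (∑ k, boolSign (σ k) * c k) =
      ∏ k, ∑ b : Bool, Real.exp (boolSign b * c k) := by
    rw [Finset.prod_univ_sum, Fintype.piFinset_univ]
    simp only [Real.exp_sum]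
  rw [h, Finset.sum_div, Real.exp_sum, ← Finset.card_univ, ← Finset.prod_const,
    ← Finset.prod_mul_distrib]
  refine Finset.prod_le_prod (fun k _ => by positivity) fun k _ => ?_
  have := Real.cosh_le_exp_half_sq (c k)
  rw [Real.cosh_eq] at this
  simp [boolSign]
  linarith

/-- Exponential moment of the Rademacher process indexed by a box of coefficients. -/
lemma sum_exp_finSup_box_le {J : Type*} [Fintype J] [Nonempty J] (B : ℝ) (hB : 0 ≤ B)
    (c : ι → J → ℝ) (hc : ∀ i j, |c i j| ≤ B / Fintype.card J)
    (G : J → κ → ℝ) (hG : ∀ j k, |G j k| ≤ 1) :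
    ∑ σ : κ → Bool, Real.exp (finSup fun i => ∑ k, boolSign (σ k) * ∑ j, c i j * G j k) ≤
      2 ^ Fintype.card κ * (2 * Real.exp (B ^ 2 * Fintype.card κ / 2)) := by
  set N : ℝ := (Fintype.card J : ℝ) with hN
  have hNpos : 0 < N := by exact Nat.cast_pos.2 Fintype.card_pos
  have hpt : ∀ σ : κ → Bool,
      Real.exp (finSup fun i => ∑ k, boolSign (σ k) * ∑ j, c i j * G j k) ≤
      ∑ j, N⁻¹ * (Real.exp (∑ k, boolSign (σ k) * (B * G j k)) +
        Real.exp (∑ k, boolSign (σ k) * (-B * G j k))) := by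
    intro σ
    have h1 : (finSup fun i => ∑ k, boolSign (σ k) * ∑ j, c i j * G j k) ≤
        ∑ j, N⁻¹ * |∑ k, boolSign (σ k) * (B * G j k)| := by
      refine finSup_le fun i => ?_
      have : ∑ k, boolSign (σ k) * ∑ j, c i j * G j k =
          ∑ j, c i j * ∑ k, boolSign (σ k) * G j k := by
        simp only [Finset.mul_sum]
        rw [Finset.sum_comm]
        refine Finset.sum_congr rfl fun j _ => Finset.sum_congr rfl fun k _ => by ring
      rw [this]
      refine Finset.sum_le_sum fun j _ => ?_
      have h2 : ∑ k, boolSign (σ k) * (B * G j k) = B * ∑ k, boolSign (σ k) * G j k := by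
        rw [Finset.mul_sum]
        exact Finset.sum_congr rfl fun k _ => by ring
      rw [h2, abs_mul, abs_of_nonneg hB, ← mul_assoc, inv_mul_eq_div]
      refine (le_abs_self _).trans ?_
      rw [abs_mul]
      exact mul_le_mul_of_nonneg_right (hc i j) (abs_nonneg _)
    refine (Real.exp_le_exp.2 h1).trans ?_
    have h3 := convexOn_exp.map_sum_le (t := Finset.univ) (w := fun _ : J => N⁻¹)
      (p := fun j => |∑ k, boolSign (σ k) * (B * G j k)|)
      (fun _ _ => by positivity) (by simp [← hN, hNpos.ne']) (fun _ _ => Set.mem_univ _)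
    simp only [smul_eq_mul] at h3
    refine h3.trans (Finset.sum_le_sum fun j _ => mul_le_mul_of_nonneg_left ?_ (by positivity))
    have h4 : ∑ k, boolSign (σ k) * (-B * G j k) = -∑ k, boolSign (σ k) * (B * G j k) := by
      rw [← Finset.sum_neg_distrib]
      exact Finset.sum_congr rfl fun k _ => by ring
    rw [h4]
    exact Real.exp_abs_le _
  have hmom : ∀ b : ℝ, b ^ 2 = B ^ 2 → ∀ j,
      ∑ σ : κ → Bool, Real.exp (∑ k, boolSign (σ k) * (b * G j k)) ≤
      2 ^ Fintype.card κ * Real.exp (B ^ 2 * Fintype.card κ / 2) := by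
    intro b hb j
    refine (sum_exp_boolSign_le _).trans ?_
    gcongr
    calc ∑ k, (b * G j k) ^ 2 ≤ ∑ _k : κ, B ^ 2 := by
          refine Finset.sum_le_sum fun k _ => ?_
          rw [mul_pow, hb]
          have : G j k ^ 2 ≤ 1 := (sq_le_one_iff_abs_le_one _).2 (hG j k)
          nlinarith [sq_nonneg B]
      _ = B ^ 2 * Fintype.card κ := by simp [mul_comm]
  calc _ ≤ ∑ σ : κ → Bool, ∑ j, N⁻¹ * (Real.exp (∑ k, boolSign (σ k) * (B * G j k)) +
        Real.exp (∑ k, boolSign (σ k) * (-B * G j k))) := Finset.sum_le_sum fun σ _ => hpt σ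
    _ = ∑ j, N⁻¹ * (∑ σ : κ → Bool, Real.exp (∑ k, boolSign (σ k) * (B * G j k)) +
        ∑ σ : κ → Bool, Real.exp (∑ k, boolSign (σ k) * (-B * G j k))) := by
      rw [Finset.sum_comm]
      simp only [← Finset.mul_sum, Finset.sum_add_distrib]
    _ ≤ ∑ _j : J, N⁻¹ * (2 ^ Fintype.card κ * (2 * Real.exp (B ^ 2 * Fintype.card κ / 2))) := by
      refine Finset.sum_le_sum fun j _ => mul_le_mul_of_nonneg_left ?_ (by positivity)
      linarith [hmom B rfl j, hmom (-B) (by ring) j]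
    _ = _ := by
      rw [Finset.sum_const, nsmul_eq_mul, Finset.card_univ, ← hN, mul_inv_cancel_left₀ hNpos.ne']

end Contraction

section Symmetrization

variable {ι κ Z : Type*} [Fintype ι] [Nonempty ι] [Fintype κ] [MeasurableSpace Z]

lemma measurable_finSup {α : Type*} [MeasurableSpace α] {f : ι → α → ℝ}
    (hf : ∀ i, Measurable (f i)) : Measurable fun a => finSup fun i => f i a := by
  convert Finset.measurable_sup' Finset.univ_nonempty fun i _ => hf i using 1
  ext a
  simp [finSup, Finset.sup'_apply]

lemma integrable_exp_finSup {α : Type*} [MeasurableSpace α] {μ : Measure α} [IsFiniteMeasure μ]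
    {f : ι → α → ℝ} (hf : ∀ i, Measurable (f i)) {M : ℝ} (hM : ∀ i a, f i a ≤ M) :
    Integrable (fun a => Real.exp (finSup fun i => f i a)) μ := by
  refine Integrable.of_bound
    (Real.measurable_exp.comp (measurable_finSup hf)).aestronglyMeasurable (Real.exp M) ?_
  refine ae_of_all _ fun a => ?_
  rw [Real.norm_eq_abs, Real.abs_exp]
  exact Real.exp_le_exp.2 (finSup_le fun i => hM i a)

lemma sum_le_card_mul_of_abs_le {f : κ → ℝ} {M : ℝ} (h : ∀ k, |f k| ≤ M) :
    ∑ k, f k ≤ Fintype.card κ * M := by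
  calc ∑ k, f k ≤ ∑ _k : κ, M := Finset.sum_le_sum fun k _ => (le_abs_self _).trans (h k)
    _ = _ := by simp

lemma sum_exp_finSup_sub_le [DecidableEq κ] (x y : ι → κ → ℝ) (Q : ℝ)
    (hx : ∑ σ : κ → Bool, Real.exp (finSup fun i => ∑ k, boolSign (σ k) * (2 * x i k)) ≤ Q)
    (hy : ∑ σ : κ → Bool, Real.exp (finSup fun i => ∑ k, boolSign (σ k) * (2 * y i k)) ≤ Q) :
    ∑ σ : κ → Bool, Real.exp (finSup fun i => ∑ k, boolSign (σ k) * (x i k - y i k)) ≤ Q := by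
  let neg : Equiv.Perm (κ → Bool) :=
    Function.Involutive.toPerm (fun σ k => !σ k) fun σ => by simp
  have hy' : ∑ σ : κ → Bool, Real.exp (finSup fun i => ∑ k, boolSign (σ k) * (-(2 * y i k))) ≤
      Q := by
    rw [← Equiv.sum_comp neg]
    simpa [neg, Function.Involutive.toPerm, boolSign_not] using hy
  have hpt : ∀ σ : κ → Bool,
      Real.exp (finSup fun i => ∑ k, boolSign (σ k) * (x i k - y i k)) ≤
      (Real.exp (finSup fun i => ∑ k, boolSign (σ k) * (2 * x i k)) +
        Real.exp (finSup fun i => ∑ k, boolSign (σ k) * (-(2 * y i k)))) / 2 := by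
    intro σ
    set a := finSup fun i => ∑ k, boolSign (σ k) * (2 * x i k)
    set b := finSup fun i => ∑ k, boolSign (σ k) * (-(2 * y i k))
    have h1 : (finSup fun i => ∑ k, boolSign (σ k) * (x i k - y i k)) ≤ a / 2 + b / 2 := by
      refine finSup_le fun i => ?_
      have ha := le_finSup (fun i => ∑ k, boolSign (σ k) * (2 * x i k)) i
      have hb := le_finSup (fun i => ∑ k, boolSign (σ k) * (-(2 * y i k))) i
      have : ∑ k, boolSign (σ k) * (x i k - y i k) =
          (∑ k, boolSign (σ k) * (2 * x i k)) / 2 +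
          (∑ k, boolSign (σ k) * (-(2 * y i k))) / 2 := by
        rw [← add_div, ← Finset.sum_add_distrib, Finset.sum_div]
        exact Finset.sum_congr rfl fun k _ => by ring
      rw [this]
      linarith
    have h2 : Real.exp (a / 2 + b / 2) = Real.exp (a / 2) * Real.exp (b / 2) := Real.exp_add _ _
    have h3 : Real.exp a = Real.exp (a / 2) ^ 2 := by
      rw [← Real.exp_nat_mul]; congr 1; push_cast; ring
    have h4 : Real.exp b = Real.exp (b / 2) ^ 2 := by
      rw [← Real.exp_nat_mul]; congr 1; push_cast; ring
    refine (Real.exp_le_exp.2 h1).trans ?_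
    rw [h2, h3, h4]
    linarith [two_mul_le_add_sq (Real.exp (a / 2)) (Real.exp (b / 2))]
  calc _ ≤ _ := Finset.sum_le_sum fun σ _ => hpt σ
    _ ≤ Q := by
      rw [← Finset.sum_div, Finset.sum_add_distrib]
      linarith

lemma measurePreserving_signSwap (μ : Measure Z) [IsProbabilityMeasure μ] (σ : κ → Bool) :
    MeasurePreserving (fun p : κ → Z × Z =>
        ((fun k => if σ k then (p k).1 else (p k).2), fun k => if σ k then (p k).2 else (p k).1))
      (Measure.pi fun _ : κ => μ.prod μ)
      ((Measure.pi fun _ : κ => μ).prod (Measure.pi fun _ : κ => μ)) := by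
  have hsw : ∀ k : κ, MeasurePreserving (fun z : Z × Z => if σ k then z else z.swap)
      (μ.prod μ) (μ.prod μ) := by
    intro k
    cases σ k
    · simpa using Measure.measurePreserving_swap
    · exact MeasurePreserving.id _
  have hpi := measurePreserving_pi (fun _ : κ => μ.prod μ) (fun _ : κ => μ.prod μ) hsw
  convert (measurePreserving_arrowProdEquivProdArrow Z Z κ (fun _ => μ)
    (fun _ => μ)).comp hpi using 1
  ext p k
  · simp only [MeasurableEquiv.arrowProdEquivProdArrow, Function.comp, MeasurableEquiv.coe_mk,
      Equiv.arrowProdEquivProdArrow, Equiv.coe_fn_mk]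
    cases σ k <;> rfl
  · simp only [MeasurableEquiv.arrowProdEquivProdArrow, Function.comp, MeasurableEquiv.coe_mk,
      Equiv.arrowProdEquivProdArrow, Equiv.coe_fn_mk]
    cases σ k <;> rfl

/-- Symmetrization: the exponential moment of the uniform deviation of empirical means is
controlled by that of the Rademacher process. -/
lemma integral_exp_finSup_le [DecidableEq κ] (μ : Measure Z) [IsProbabilityMeasure μ]
    (l : ι → Z → ℝ)
    (hl : ∀ i, Measurable (l i)) (M : ℝ) (hM : ∀ i z, |l i z| ≤ M) (Q : ℝ)
    (hQ : ∀ S : κ → Z,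
      ∑ σ : κ → Bool, Real.exp (finSup fun i => ∑ k, boolSign (σ k) * (2 * l i (S k))) ≤
        2 ^ Fintype.card κ * Q) :
    ∫ S, Real.exp (finSup fun i => ∑ k, (∫ z, l i z ∂μ - l i (S k)))
      ∂(Measure.pi fun _ : κ => μ) ≤ Q := by
  set P := Measure.pi fun _ : κ => μ with hP
  have hlint : ∀ i, Integrable (l i) μ := fun i =>
    Integrable.of_bound (hl i).aestronglyMeasurable M (ae_of_all _ (hM i))
  have hsub : ∀ i z z', |l i z' - l i z| ≤ 2 * M := fun i z z' =>
    (abs_sub _ _).trans (by linarith [hM i z, hM i z'])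
  let Φ : (κ → Z) × (κ → Z) → ℝ := fun SS =>
    Real.exp (finSup fun i => ∑ k, (l i (SS.2 k) - l i (SS.1 k)))
  have hΦ : Integrable Φ (P.prod P) :=
    integrable_exp_finSup (fun i => by fun_prop)
      (M := Fintype.card κ * (2 * M)) fun i a => sum_le_card_mul_of_abs_le fun k => hsub i _ _
  have hΦS : ∀ S, Integrable (fun S' => Φ (S, S')) P := fun S =>
    integrable_exp_finSup (fun i => by fun_prop)
      (M := Fintype.card κ * (2 * M)) fun i a => sum_le_card_mul_of_abs_le fun k => hsub i _ _
  have hghost : ∀ S : κ → Z, Real.exp (finSup fun i => ∑ k, (∫ z, l i z ∂μ - l i (S k))) ≤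
      ∫ S', Φ (S, S') ∂P := by
    intro S
    obtain ⟨i, hi⟩ := exists_eq_finSup fun i => ∑ k, (∫ z, l i z ∂μ - l i (S k))
    rw [hi]
    have hInt : ∀ k, Integrable (fun S' : κ → Z => l i (S' k) - l i (S k)) P := fun k =>
      Integrable.of_bound (Measurable.aestronglyMeasurable (by fun_prop)) (2 * M)
        (ae_of_all _ fun S' => hsub i _ _)
    have heq : ∑ k, (∫ z, l i z ∂μ - l i (S k)) =
        ∫ S', ∑ k, (l i (S' k) - l i (S k)) ∂P := by
      rw [integral_finsetSum _ fun k _ => hInt k]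
      refine Finset.sum_congr rfl fun k _ => ?_
      have h1 : Integrable (fun S' : κ → Z => l i (S' k)) P :=
        Integrable.of_bound (Measurable.aestronglyMeasurable (by fun_prop)) M
          (ae_of_all _ fun S' => hM i _)
      rw [integral_sub h1 (integrable_const _)]
      rw [integral_comp_eval (μ := fun _ : κ => μ) (hl i).aestronglyMeasurable]
      simp
    rw [heq]
    have hexpint : Integrable (fun S' => Real.exp (∑ k, (l i (S' k) - l i (S k)))) P :=
      Integrable.of_bound (Measurable.aestronglyMeasurable (by fun_prop))
        (Real.exp (Fintype.card κ * (2 * M)))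
        (ae_of_all _ fun S' => by
          rw [Real.norm_eq_abs, Real.abs_exp]
          exact Real.exp_le_exp.2 (sum_le_card_mul_of_abs_le fun k => hsub i _ _))
    have hj := convexOn_exp.map_integral_le (μ := P)
      (f := fun S' => ∑ k, (l i (S' k) - l i (S k))) Real.continuous_exp.continuousOn
      isClosed_univ (ae_of_all _ fun _ => Set.mem_univ _)
      (integrable_finsetSum _ fun k _ => hInt k) hexpint
    refine hj.trans (integral_mono hexpint (hΦS S) fun S' => ?_)
    exact Real.exp_le_exp.2 (le_finSup (fun i => ∑ k, (l i (S' k) - l i (S k))) i)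
  have hstep : ∫ S, Real.exp (finSup fun i => ∑ k, (∫ z, l i z ∂μ - l i (S k))) ∂P ≤
      ∫ SS, Φ SS ∂(P.prod P) := by
    rw [integral_prod _ hΦ]
    refine integral_mono ?_ hΦ.integral_prod_left hghost
    have hb : ∀ i, |∫ z, l i z ∂μ| ≤ M := fun i => by
      simpa using norm_integral_le_of_norm_le_const (μ := μ) (f := l i) (ae_of_all _ (hM i))
    exact integrable_exp_finSup (fun i => by fun_prop)
      (M := Fintype.card κ * (2 * M)) fun i a => sum_le_card_mul_of_abs_le fun k =>
        (abs_sub _ _).trans (by linarith [hM i (a k), hb i])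
  refine hstep.trans ?_
  set ρ := Measure.pi fun _ : κ => μ.prod μ with hρ
  let Ψ : (κ → Bool) → (κ → Z × Z) → ℝ := fun σ p =>
    Real.exp (finSup fun i => ∑ k, boolSign (σ k) * (l i (p k).2 - l i (p k).1))
  have hΨint : ∀ σ, Integrable (Ψ σ) ρ := fun σ =>
    integrable_exp_finSup (fun i => by fun_prop)
      (M := Fintype.card κ * (2 * M)) fun i a => sum_le_card_mul_of_abs_le fun k => by
        rw [abs_mul, abs_boolSign, one_mul]
        exact hsub i _ _
  have hΨ : ∀ σ, ∫ SS, Φ SS ∂(P.prod P) = ∫ p, Ψ σ p ∂ρ := by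
    intro σ
    have hmp := measurePreserving_signSwap μ σ
    rw [← hmp.map_eq] at hΦ ⊢
    rw [integral_map hmp.measurable.aemeasurable hΦ.aestronglyMeasurable]
    refine integral_congr_ae (ae_of_all _ fun p => ?_)
    simp only [Φ, Ψ]
    congr 2
    ext i
    refine Finset.sum_congr rfl fun k _ => ?_
    cases σ k <;> simp [boolSign]
  have hsum : 2 ^ Fintype.card κ * ∫ SS, Φ SS ∂(P.prod P) = ∫ p, ∑ σ, Ψ σ p ∂ρ := by
    rw [integral_finsetSum _ fun σ _ => hΨint σ, ← Finset.sum_congr rfl fun σ _ => hΨ σ]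
    simp
  have hfin : ∫ p, ∑ σ, Ψ σ p ∂ρ ≤ 2 ^ Fintype.card κ * Q := by
    have : ∫ p, ∑ σ, Ψ σ p ∂ρ ≤ ∫ _p, 2 ^ Fintype.card κ * Q ∂ρ := by
      refine integral_mono (integrable_finsetSum _ fun σ _ => hΨint σ) (integrable_const _)
        fun p => ?_
      exact sum_exp_finSup_sub_le (fun i k => l i (p k).2) (fun i k => l i (p k).1) _
        (hQ fun k => (p k).2) (hQ fun k => (p k).1)
    simpa using this
  rw [← hsum] at hfin
  exact le_of_mul_le_mul_left hfin (by positivity)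

end Symmetrization

/-- Uniform deviation of the empirical mean of a contraction of functions in a scaled
absolutely convex hull of bounded features. -/
lemma measureReal_exists_deviation_le {ι κ J Z : Type*} [Fintype ι] [Nonempty ι] [Fintype κ]
    [Nonempty κ] [Fintype J] [Nonempty J] [MeasurableSpace Z]
    (μ : Measure Z) [IsProbabilityMeasure μ] (g : J → Z → ℝ) (hg : ∀ j, Measurable (g j))
    (hg1 : ∀ j z, |g j z| ≤ 1) {B : ℝ} (hB : 0 < B) (c : ι → J → ℝ)
    (hc : ∀ i j, |c i j| ≤ B / Fintype.card J) (φ : ℝ → ℝ)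
    (hφ : ∀ u v, |φ u - φ v| ≤ |u - v|) (hφ0 : φ 0 = 0) {t : ℝ} (ht : 0 ≤ t) :
    (Measure.pi fun _ : κ => μ).real
      {S | ∃ i, t ≤ ∫ z, φ (∑ j, c i j * g j z) ∂μ -
        (1 / Fintype.card κ : ℝ) * ∑ k, φ (∑ j, c i j * g j (S k))} ≤
      2 * Real.exp (-(t ^ 2 * Fintype.card κ / (8 * B ^ 2))) := by
  classical
  set m : ℝ := (Fintype.card κ : ℝ) with hm
  have hm0 : 0 < m := Nat.cast_pos.2 Fintype.card_pos
  set a : ℝ := t / (4 * B ^ 2) with ha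
  have ha0 : 0 ≤ a := by positivity
  have hφabs : ∀ u, |φ u| ≤ |u| := fun u => by simpa [hφ0] using hφ u 0
  have hφm : Measurable φ := by
    have : LipschitzWith 1 φ := LipschitzWith.of_dist_le_mul fun u v => by
      simpa [Real.dist_eq] using hφ u v
    exact this.continuous.measurable
  have hF : ∀ i z, |∑ j, c i j * g j z| ≤ B := by
    intro i z
    calc |∑ j, c i j * g j z| ≤ ∑ j, |c i j * g j z| := Finset.abs_sum_le_sum_abs _ _
      _ ≤ ∑ _j : J, B / Fintype.card J := by
        refine Finset.sum_le_sum fun j _ => ?_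
        rw [abs_mul]
        calc |c i j| * |g j z| ≤ |c i j| * 1 := by gcongr; exact hg1 j z
          _ ≤ _ := by simpa using hc i j
      _ = B := by
        rw [Finset.sum_const, nsmul_eq_mul, Finset.card_univ]
        field_simp
  let l : ι → Z → ℝ := fun i z => a * φ (∑ j, c i j * g j z)
  have hlm : ∀ i, Measurable (l i) := fun i =>
    (hφm.comp (Finset.measurable_sum _ fun j _ => (hg j).const_mul _)).const_mul _
  have hlb : ∀ i z, |l i z| ≤ a * B := fun i z => by
    rw [abs_mul, abs_of_nonneg ha0]
    exact mul_le_mul_of_nonneg_left ((hφabs _).trans (hF i z)) ha0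
  have hmgf := integral_exp_finSup_le (κ := κ) μ l hlm (a * B) hlb
    (2 * Real.exp ((2 * a * B) ^ 2 * m / 2)) fun S => by
      refine le_trans (sum_exp_finSup_contraction
        (fun i k => ∑ j, (2 * a * c i j) * g j (S k)) _ ?_ ?_)
        (sum_exp_finSup_box_le (2 * a * B) (by positivity) (fun i j => 2 * a * c i j) ?_
          (fun j k => g j (S k)) fun j k => hg1 j _)
      · intro i i' k
        simp only [l, mul_assoc (2 * a), ← Finset.mul_sum]
        rw [← mul_assoc, ← mul_assoc, ← mul_sub, ← mul_sub, abs_mul (2 * a), abs_mul (2 * a)]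
        exact mul_le_mul_of_nonneg_left (hφ _ _) (abs_nonneg _)
      · intro i k
        simp only [l, mul_assoc (2 * a), ← Finset.mul_sum]
        rw [← mul_assoc, abs_mul (2 * a), abs_mul (2 * a)]
        exact mul_le_mul_of_nonneg_left (hφabs _) (abs_nonneg _)
      · intro i j
        rw [abs_mul, abs_of_nonneg (by positivity : 0 ≤ 2 * a), mul_div_assoc]
        gcongr
        exact hc i j
  have hInt : Integrable (fun S : κ → Z => Real.exp (1 * finSup fun i =>
      ∑ k, (∫ z, l i z ∂μ - l i (S k)))) (Measure.pi fun _ : κ => μ) := by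
    simp only [one_mul]
    have hb : ∀ i, |∫ z, l i z ∂μ| ≤ a * B := fun i => by
      simpa using norm_integral_le_of_norm_le_const (μ := μ) (f := l i) (ae_of_all _ (hlb i))
    exact integrable_exp_finSup (fun i => by fun_prop)
      (M := Fintype.card κ * (2 * (a * B))) fun i S => sum_le_card_mul_of_abs_le fun k =>
        (abs_sub _ _).trans (by linarith [hlb i (S k), hb i])
  have hch := ProbabilityTheory.measure_ge_le_exp_mul_mgf (a * m * t) zero_le_one hInt
  simp only [ProbabilityTheory.mgf, one_mul] at hch
  refine (measureReal_mono ?_).trans (hch.trans ?_)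
  · rintro S ⟨i, hi⟩
    refine le_trans ?_ (le_finSup (fun i => ∑ k, (∫ z, l i z ∂μ - l i (S k))) i)
    have : ∑ k, (∫ z, l i z ∂μ - l i (S k)) = a * m * (∫ z, φ (∑ j, c i j * g j z) ∂μ -
        (1 / m : ℝ) * ∑ k, φ (∑ j, c i j * g j (S k))) := by
      simp only [l]
      rw [Finset.sum_sub_distrib, ← Finset.mul_sum, integral_const_mul, Finset.sum_const,
        nsmul_eq_mul, Finset.card_univ, ← hm]
      field_simp
    rw [this]
    gcongr
  · refine (mul_le_mul_of_nonneg_left hmgf (Real.exp_pos _).le).trans (le_of_eq ?_)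
    rw [mul_left_comm, ← Real.exp_add]
    congr 2
    rw [ha]
    field_simp
    ring

/-- Concentration of the `L¹` distance between an average of i.i.d. bounded random functions and
its mean. -/
lemma measureReal_integral_abs_sum_sub_le {A κ Z : Type*} [Fintype κ] [MeasurableSpace A]
    [MeasurableSpace Z] (ν : Measure A) [IsProbabilityMeasure ν] (μ : Measure Z)
    [IsProbabilityMeasure μ] (h : A → Z → ℝ)
    (hm : Measurable (Function.uncurry h)) {B : ℝ} (hB : 0 < B) (hb : ∀ a z, |h a z| ≤ B)
    {t : ℝ} (ht : 0 ≤ t) :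
    (Measure.pi fun _ : κ => ν).real
      {W | Fintype.card κ * t ≤ ∫ z, |∑ k, (h (W k) z - ∫ a, h a z ∂ν)| ∂μ} ≤
      2 * Real.exp (-(t ^ 2 * Fintype.card κ / (2 * B ^ 2))) := by
  set D : ℝ := (Fintype.card κ : ℝ) with hD
  set P := Measure.pi fun _ : κ => ν with hP
  set s : ℝ := t / B ^ 2 with hs
  have hs0 : 0 ≤ s := by positivity
  set hbar : Z → ℝ := fun z => ∫ a, h a z ∂ν with hhbar
  have hbarm : Measurable hbar :=
    (hm.stronglyMeasurable.integral_prod_left (μ := ν)).measurable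
  have hbarb : ∀ z, |hbar z| ≤ B := fun z => by
    simpa using norm_integral_le_of_norm_le_const (μ := ν) (f := fun a => h a z)
      (ae_of_all _ fun a => hb a z)
  let Y : (κ → A) → Z → ℝ := fun W z => ∑ k, (h (W k) z - hbar z)
  have hYm : Measurable (Function.uncurry Y) := by
    refine Finset.measurable_sum _ fun k _ => Measurable.sub ?_ (hbarm.comp measurable_snd)
    have hk : Measurable fun q : (κ → A) × Z => (q.1 k, q.2) :=
      ((measurable_pi_apply k).comp measurable_fst).prodMk measurable_snd
    exact hm.comp hk
  have hYmW : ∀ W, Measurable (Y W) := fun W => hYm.comp measurable_prodMk_left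
  have hYb : ∀ W z, |Y W z| ≤ D * (2 * B) := fun W z => by
    calc |Y W z| ≤ ∑ k, |h (W k) z - hbar z| := Finset.abs_sum_le_sum_abs _ _
      _ ≤ ∑ _k : κ, 2 * B := Finset.sum_le_sum fun k _ =>
        (abs_sub _ _).trans (by linarith [hb (W k) z, hbarb z])
      _ = _ := by simp [hD]
  have hexpb : ∀ b W z, |b| = s → |Real.exp (b * Y W z)| ≤ Real.exp (s * (D * (2 * B))) := by
    intro b W z hbs
    rw [Real.abs_exp, Real.exp_le_exp]
    refine (le_abs_self _).trans ?_
    rw [abs_mul, hbs]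
    exact mul_le_mul_of_nonneg_left (hYb W z) hs0
  have hexpint : ∀ b, |b| = s →
      Integrable (fun q : (κ → A) × Z => Real.exp (b * Y q.1 q.2)) (P.prod μ) := fun b hbs =>
    Integrable.of_bound
      (Real.measurable_exp.comp (hYm.const_mul b)).aestronglyMeasurable
      (Real.exp (s * (D * (2 * B)))) (ae_of_all _ fun q => hexpb b q.1 q.2 hbs)
  have hexpintW : ∀ b W, |b| = s → Integrable (fun z => Real.exp (b * Y W z)) μ :=
    fun b W hbs => Integrable.of_bound
      (Real.measurable_exp.comp ((hYmW W).const_mul b)).aestronglyMeasurable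
      (Real.exp (s * (D * (2 * B)))) (ae_of_all _ fun z => hexpb b W z hbs)
  have hmom : ∀ b, |b| = s →
      ∫ W, ∫ z, Real.exp (b * Y W z) ∂μ ∂P ≤ Real.exp (B ^ 2 * s ^ 2 / 2 * D) := by
    intro b hbs
    rw [integral_integral_swap (hexpint b hbs)]
    have hz : ∀ z, ∫ W, Real.exp (b * Y W z) ∂P ≤ Real.exp (B ^ 2 * s ^ 2 / 2 * D) := by
      intro z
      have h1 : ∀ W, Real.exp (b * Y W z) = ∏ k, Real.exp (b * (h (W k) z - hbar z)) := by
        intro W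
        rw [← Real.exp_sum, ← Finset.mul_sum]
      simp_rw [h1]
      rw [integral_fintype_prod_eq_pow (fun a => Real.exp (b * (h a z - hbar z)))]
      have hsg := (ProbabilityTheory.hasSubgaussianMGF_of_mem_Icc (μ := ν) (a := -B) (b := B)
        (X := fun a => h a z) (hm.comp measurable_prodMk_right).aemeasurable
        (ae_of_all _ fun a => abs_le.1 (hb a z))).mgf_le b
      have hpar : (((‖B - -B‖₊ / 2) ^ 2 : NNReal) : ℝ) = B ^ 2 := by
        push_cast
        rw [Real.norm_eq_abs, sub_neg_eq_add, abs_of_pos (by linarith)]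
        ring
      rw [hpar, ← sq_abs b, hbs] at hsg
      refine (pow_le_pow_left₀ (integral_nonneg fun a => (Real.exp_pos _).le) hsg _).trans ?_
      rw [← Real.exp_nat_mul, mul_comm]
    have h2 : ∫ z, ∫ W, Real.exp (b * Y W z) ∂P ∂μ ≤
        ∫ _z, Real.exp (B ^ 2 * s ^ 2 / 2 * D) ∂μ :=
      integral_mono (hexpint b hbs).integral_prod_right (integrable_const _) hz
    simpa using h2
  let X : (κ → A) → ℝ := fun W => ∫ z, |Y W z| ∂μ
  have hXm : Measurable X :=
    ((hYm.abs).stronglyMeasurable.integral_prod_right (ν := μ)).measurable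
  have hXb : ∀ W, |X W| ≤ D * (2 * B) := fun W => by
    simpa using norm_integral_le_of_norm_le_const (μ := μ) (f := fun z => |Y W z|)
      (ae_of_all _ fun z => by simpa using hYb W z)
  have hInt : Integrable (fun W => Real.exp (s * X W)) P :=
    Integrable.of_bound (Real.measurable_exp.comp (hXm.const_mul s)).aestronglyMeasurable
      (Real.exp (s * (D * (2 * B)))) (ae_of_all _ fun W => by
        rw [Real.norm_eq_abs, Real.abs_exp, Real.exp_le_exp]
        exact mul_le_mul_of_nonneg_left ((le_abs_self _).trans (hXb W)) hs0)
  have hs1 : |s| = s := abs_of_nonneg hs0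
  have hs2 : |-s| = s := by rw [abs_neg, hs1]
  have hpt : ∀ W, Real.exp (s * X W) ≤
      ∫ z, Real.exp (s * Y W z) ∂μ + ∫ z, Real.exp (-s * Y W z) ∂μ := by
    intro W
    rw [← integral_add (hexpintW s W hs1) (hexpintW (-s) W hs2)]
    have hle : ∀ z, Real.exp (s * |Y W z|) ≤ Real.exp (s * Y W z) + Real.exp (-s * Y W z) := by
      intro z
      have := Real.exp_abs_le (s * Y W z)
      rwa [abs_mul, hs1, ← neg_mul] at this
    have hi : Integrable (fun z => Real.exp (s * |Y W z|)) μ :=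
      Integrable.of_bound
        (Real.measurable_exp.comp ((hYmW W).abs.const_mul s)).aestronglyMeasurable
        (Real.exp (s * (D * (2 * B)))) (ae_of_all _ fun z => by
          rw [Real.norm_eq_abs, Real.abs_exp, Real.exp_le_exp]
          exact mul_le_mul_of_nonneg_left (hYb W z) hs0)
    have hYi : Integrable (fun z => s * |Y W z|) μ :=
      Integrable.of_bound ((hYmW W).abs.const_mul s).aestronglyMeasurable (s * (D * (2 * B)))
        (ae_of_all _ fun z => by
          rw [Real.norm_eq_abs, abs_mul, abs_abs, hs1]
          exact mul_le_mul_of_nonneg_left (hYb W z) hs0)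
    have hj := convexOn_exp.map_integral_le (μ := μ) (f := fun z => s * |Y W z|)
      Real.continuous_exp.continuousOn isClosed_univ (ae_of_all _ fun _ => Set.mem_univ _) hYi hi
    rw [integral_const_mul] at hj
    exact hj.trans (integral_mono hi
      ((hexpintW s W hs1).add (hexpintW (-s) W hs2)) hle)
  have hch := ProbabilityTheory.measure_ge_le_exp_mul_mgf (D * t) hs0 hInt
  refine hch.trans ?_
  have hmgf : ProbabilityTheory.mgf X P s ≤ 2 * Real.exp (B ^ 2 * s ^ 2 / 2 * D) := by
    have h1 := (hexpint s hs1).integral_prod_left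
    have h2 := (hexpint (-s) hs2).integral_prod_left
    refine (integral_mono hInt (h1.add h2) hpt).trans ?_
    have := integral_add h1 h2
    simp only [Pi.add_apply]
    rw [this]
    linarith [hmom s hs1, hmom (-s) hs2]
  refine (mul_le_mul_of_nonneg_left hmgf (Real.exp_pos _).le).trans (le_of_eq ?_)
  rw [mul_left_comm, ← Real.exp_add]
  congr 2
  rw [hs]
  field_simp
  ring

section HingeRisk

variable {d : ℕ} {Pi : Measure (EuclideanSpace ℝ (Fin d) × ℝ)} [IsProbabilityMeasure Pi]

lemma abs_hinge_sub_hinge_le (u v : ℝ) : |max 0 (1 - u) - max 0 (1 - v)| ≤ |u - v| := by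
  rw [max_comm 0, max_comm 0]
  refine (abs_max_sub_max_le_abs _ _ _).trans (le_of_eq ?_)
  rw [sub_sub_sub_cancel_left, abs_sub_comm]

lemma ae_label (hPi : Pi {z | z.2 = 1 ∨ z.2 = -1} = 1) : ∀ᵐ z ∂Pi, z.2 = 1 ∨ z.2 = -1 := by
  have hms : MeasurableSet {z : EuclideanSpace ℝ (Fin d) × ℝ | z.2 = 1 ∨ z.2 = -1} :=
    (measurable_snd (measurableSet_singleton 1)).union
      (measurable_snd (measurableSet_singleton (-1)))
  exact (prob_compl_eq_zero_iff hms).2 hPi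

lemma integrable_hinge (hPi : Pi {z | z.2 = 1 ∨ z.2 = -1} = 1)
    {f : EuclideanSpace ℝ (Fin d) → ℝ} (hf : Measurable f) {M : ℝ} (hM : ∀ x, |f x| ≤ M) :
    Integrable (fun z => max 0 (1 - z.2 * f z.1)) Pi := by
  refine Integrable.of_bound (Measurable.aestronglyMeasurable (by fun_prop)) (1 + M) ?_
  filter_upwards [ae_label hPi] with z hz
  rw [Real.norm_eq_abs, abs_of_nonneg (le_max_left _ _)]
  have := abs_le.1 (hM z.1)
  refine max_le (by linarith) ?_
  rcases hz with h | h <;> rw [h] <;> linarith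

lemma hingeRisk_sub_le (hPi : Pi {z | z.2 = 1 ∨ z.2 = -1} = 1)
    {f g : EuclideanSpace ℝ (Fin d) → ℝ} (hf : Measurable f) (hg : Measurable g) {M N : ℝ}
    (hM : ∀ x, |f x| ≤ M) (hN : ∀ x, |g x| ≤ N) :
    hingeRisk Pi f - hingeRisk Pi g ≤ ∫ z, |f z.1 - g z.1| ∂Pi := by
  have hfi := integrable_hinge hPi hf hM
  have hgi := integrable_hinge hPi hg hN
  rw [hingeRisk, hingeRisk, ← integral_sub hfi hgi]
  refine integral_mono_ae (hfi.sub hgi) ?_ ?_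
  · refine Integrable.of_bound (Measurable.aestronglyMeasurable (by fun_prop)) (M + N)
      (ae_of_all _ fun z => ?_)
    rw [Real.norm_eq_abs, abs_abs]
    exact (abs_sub _ _).trans (add_le_add (hM _) (hN _))
  · filter_upwards [ae_label hPi] with z hz
    refine (le_abs_self _).trans ((abs_hinge_sub_hinge_le _ _).trans (le_of_eq ?_))
    rw [← mul_sub, abs_mul]
    rcases hz with h | h <;> simp [h]

end HingeRisk

section RandomFeatures

variable {d D : ℕ}

lemma measurable_rffFun (W : Fin D → EuclideanSpace ℝ (Fin d)) (β : (Fin D → ℝ) × (Fin D → ℝ)) :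
    Measurable (rffFun W β) := by
  unfold rffFun
  fun_prop

lemma abs_mul_cos_add_mul_sin_le {a b η : ℝ} (ha : |a| ≤ η) (hb : |b| ≤ η) (θ : ℝ) :
    |a * Real.cos θ + b * Real.sin θ| ≤ 2 * η := by
  refine (abs_add_le _ _).trans ?_
  rw [abs_mul, abs_mul]
  have h1 : |a| * |Real.cos θ| ≤ |a| :=
    mul_le_of_le_one_right (abs_nonneg _) (Real.abs_cos_le_one _)
  have h2 : |b| * |Real.sin θ| ≤ |b| :=
    mul_le_of_le_one_right (abs_nonneg _) (Real.abs_sin_le_one _)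
  linarith

lemma abs_rffFun_le (W : Fin D → EuclideanSpace ℝ (Fin d)) {β : (Fin D → ℝ) × (Fin D → ℝ)} {η : ℝ}
    (hβ : ∀ j, |β.1 j| ≤ η ∧ |β.2 j| ≤ η) (x : EuclideanSpace ℝ (Fin d)) :
    |rffFun W β x| ≤ D * (2 * η) := by
  refine (Finset.abs_sum_le_sum_abs _ _).trans ?_
  refine (Finset.sum_le_sum fun j _ =>
    abs_mul_cos_add_mul_sin_le (hβ j).1 (hβ j).2 _).trans (le_of_eq ?_)
  simp

lemma rffFun_sub (W : Fin D → EuclideanSpace ℝ (Fin d)) (β β' : (Fin D → ℝ) × (Fin D → ℝ))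
    (x : EuclideanSpace ℝ (Fin d)) : rffFun W (β - β') x = rffFun W β x - rffFun W β' x := by
  simp only [rffFun, ← Finset.sum_sub_distrib]
  refine Finset.sum_congr rfl fun j _ => ?_
  simp only [Prod.fst_sub, Prod.snd_sub, Pi.sub_apply]
  ring

/-- A finite net of the coefficient box. -/
lemma exists_finset_net_inBox (D : ℕ) {C : ℝ} (hC : 0 ≤ C) {η : ℝ} (hη : 0 < η) :
    ∃ T : Finset ((Fin D → ℝ) × (Fin D → ℝ)), T.Nonempty ∧ (∀ β ∈ T, inBox C β) ∧
      ∀ β, inBox C β → ∃ β' ∈ T, ∀ j, |(β - β').1 j| ≤ η ∧ |(β - β').2 j| ≤ η := by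
  have hCD : 0 ≤ C / D := by positivity
  have hiff : ∀ (r : ℝ), 0 ≤ r → ∀ β : (Fin D → ℝ) × (Fin D → ℝ),
      ‖β‖ ≤ r ↔ ∀ j, |β.1 j| ≤ r ∧ |β.2 j| ≤ r := by
    intro r hr β
    rw [Prod.norm_def, max_le_iff, pi_norm_le_iff_of_nonneg hr, pi_norm_le_iff_of_nonneg hr,
      ← forall_and]
    rfl
  obtain ⟨t, hts, htf, hcov⟩ := finite_cover_balls_of_compact
    (isCompact_closedBall (0 : (Fin D → ℝ) × (Fin D → ℝ)) (C / D)) hη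
  have hmem : ∀ β, inBox C β → ∃ β' ∈ t, ∀ j, |(β - β').1 j| ≤ η ∧ |(β - β').2 j| ≤ η := by
    intro β hβ
    have h1 : β ∈ Metric.closedBall (0 : (Fin D → ℝ) × (Fin D → ℝ)) (C / D) := by
      rw [mem_closedBall_zero_iff]
      exact (hiff _ hCD β).2 hβ
    obtain ⟨β', hβ', hlt⟩ := Set.mem_iUnion₂.1 (hcov h1)
    rw [mem_ball_iff_norm] at hlt
    exact ⟨β', hβ', (hiff _ hη.le _).1 hlt.le⟩
  refine ⟨htf.toFinset, ?_, ?_, ?_⟩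
  · obtain ⟨β', hβ', -⟩ := hmem 0 fun j => by simpa using hCD
    exact ⟨β', by simpa using hβ'⟩
  · intro β hβ
    have := hts (by simpa using hβ)
    rw [mem_closedBall_zero_iff] at this
    exact (hiff _ hCD β).1 this
  · intro β hβ
    obtain ⟨β', hβ', h⟩ := hmem β hβ
    exact ⟨β', by simpa using hβ', h⟩

/-- The empirical hinge risk. -/
noncomputable def empHinge {m : ℕ} (S : Fin m → EuclideanSpace ℝ (Fin d) × ℝ)
    (f : EuclideanSpace ℝ (Fin d) → ℝ) : ℝ :=
  (1 / m : ℝ) * ∑ i, max 0 (1 - (S i).2 * f (S i).1)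

lemma empHinge_sub_le {m : ℕ} (hm : 0 < m) {S : Fin m → EuclideanSpace ℝ (Fin d) × ℝ}
    (hS : ∀ i, (S i).2 = 1 ∨ (S i).2 = -1) {f g : EuclideanSpace ℝ (Fin d) → ℝ} {ε : ℝ}
    (h : ∀ x, |f x - g x| ≤ ε) : empHinge S f - empHinge S g ≤ ε := by
  have hm' : (0 : ℝ) < m := Nat.cast_pos.2 hm
  rw [empHinge, empHinge, ← mul_sub, ← Finset.sum_sub_distrib]
  have : ∑ i, (max 0 (1 - (S i).2 * f (S i).1) - max 0 (1 - (S i).2 * g (S i).1)) ≤ m * ε := by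
    calc _ ≤ ∑ _i : Fin m, ε := by
          refine Finset.sum_le_sum fun i _ => ?_
          refine (le_abs_self _).trans ((abs_hinge_sub_hinge_le _ _).trans ?_)
          rw [← mul_sub, abs_mul]
          rcases hS i with h' | h' <;> simpa [h'] using h _
      _ = _ := by simp
  calc _ ≤ (1 / m : ℝ) * (m * ε) := by gcongr
    _ = ε := by field_simp

lemma ae_pi_label {m : ℕ} {Pi : Measure (EuclideanSpace ℝ (Fin d) × ℝ)} [IsProbabilityMeasure Pi]
    (hPi : Pi {z | z.2 = 1 ∨ z.2 = -1} = 1) :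
    ∀ᵐ S ∂(Measure.pi fun _ : Fin m => Pi), ∀ i, (S i).2 = 1 ∨ (S i).2 = -1 :=
  ae_all_iff.2 fun i =>
    (measurePreserving_eval (fun _ : Fin m => Pi) i).quasiMeasurePreserving.ae (ae_label hPi)

/-- Uniform deviation between true and empirical hinge risks over finitely many coefficients in
the box, in the direction selected by the sign `s`. -/
lemma measure_exists_hingeRisk_deviation_le {m : ℕ} (hm : 0 < m) (hD : 0 < D)
    {Pi : Measure (EuclideanSpace ℝ (Fin d) × ℝ)} [IsProbabilityMeasure Pi]
    (hPi : Pi {z | z.2 = 1 ∨ z.2 = -1} = 1) (W : Fin D → EuclideanSpace ℝ (Fin d)) {C : ℝ}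
    (hC : 0 < C) {T : Finset ((Fin D → ℝ) × (Fin D → ℝ))} (hT : T.Nonempty)
    (hTC : ∀ β ∈ T, inBox C β) {s : ℝ} (hs : |s| = 1) {t : ℝ} (ht : 0 ≤ t) :
    (Measure.pi fun _ : Fin m => Pi)
      {S | ∃ β ∈ T, t ≤ s * (hingeRisk Pi (rffFun W β) - empHinge S (rffFun W β))} ≤
      ENNReal.ofReal (2 * Real.exp (-(t ^ 2 * m / (32 * C ^ 2)))) := by
  have : Nonempty T := hT.to_subtype
  have : Nonempty (Fin m) := ⟨⟨0, hm⟩⟩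
  have : Nonempty (Fin D) := ⟨⟨0, hD⟩⟩
  have hm' : (m : ℝ) ≠ 0 := Nat.cast_ne_zero.2 hm.ne'
  let clip : ℝ → ℝ := fun y => max (-1) (min 1 y)
  have hclip1 : ∀ y, |clip y| ≤ 1 := fun y =>
    abs_le.2 ⟨le_max_left _ _, max_le (by norm_num) (min_le_left _ _)⟩
  have hclip : ∀ y, y = 1 ∨ y = -1 → clip y = y := by
    rintro y (rfl | rfl) <;> norm_num [clip]
  have hclipm : Measurable clip := by fun_prop
  let g : Fin D ⊕ Fin D → EuclideanSpace ℝ (Fin d) × ℝ → ℝ := fun j z =>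
    clip z.2 * Sum.elim (fun j => Real.cos ⟪W j, z.1⟫_ℝ) (fun j => Real.sin ⟪W j, z.1⟫_ℝ) j
  have hgm : ∀ j, Measurable (g j) := by
    rintro (j | j) <;> simp only [g, Sum.elim_inl, Sum.elim_inr] <;> fun_prop
  have hg1 : ∀ j z, |g j z| ≤ 1 := by
    rintro (j | j) z <;> simp only [g, Sum.elim_inl, Sum.elim_inr, abs_mul]
    · exact mul_le_one₀ (hclip1 _) (abs_nonneg _) (Real.abs_cos_le_one _)
    · exact mul_le_one₀ (hclip1 _) (abs_nonneg _) (Real.abs_sin_le_one _)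
  have hsum : ∀ (β : (Fin D → ℝ) × (Fin D → ℝ)) z,
      ∑ j, Sum.elim β.1 β.2 j * g j z = clip z.2 * rffFun W β z.1 := by
    intro β z
    simp only [g, Fintype.sum_sum_type, Sum.elim_inl, Sum.elim_inr, rffFun, Finset.mul_sum,
      ← Finset.sum_add_distrib]
    exact Finset.sum_congr rfl fun j _ => by ring
  have hmain := measureReal_exists_deviation_le (κ := Fin m) Pi g hgm hg1
    (by positivity : 0 < 2 * C) (fun (β : T) => Sum.elim β.1.1 β.1.2)
    (by
      rintro ⟨β, hβ⟩ j
      have h2 : 2 * C / (Fintype.card (Fin D ⊕ Fin D) : ℝ) = C / D := by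
        rw [Fintype.card_sum, Fintype.card_fin]
        push_cast
        rw [← two_mul, mul_div_mul_left _ _ two_ne_zero]
      rw [h2]
      rcases j with j | j
      · exact (hTC β hβ j).1
      · exact (hTC β hβ j).2)
    (fun u => s * (max 0 (1 - u) - 1))
    (fun u v => by
      rw [← mul_sub, abs_mul, hs, one_mul, sub_sub_sub_cancel_right]
      exact abs_hinge_sub_hinge_le u v)
    (by simp) ht
  simp only [hsum, Fintype.card_fin] at hmain
  have h8 : 8 * (2 * C) ^ 2 = 32 * C ^ 2 := by ring
  rw [h8] at hmain
  refine le_trans (measure_mono_ae ?_) (ENNReal.le_ofReal_iff_toReal_le (measure_ne_top _ _)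
    (by positivity) |>.2 hmain)
  filter_upwards [ae_pi_label hPi] with S hS
  rintro ⟨β, hβ, hle⟩
  refine ⟨⟨β, hβ⟩, hle.trans (le_of_eq ?_)⟩
  have hR : ∫ z, s * (max 0 (1 - clip z.2 * rffFun W β z.1) - 1) ∂Pi =
      s * (hingeRisk Pi (rffFun W β) - 1) := by
    have hcongr : ∫ z, s * (max 0 (1 - clip z.2 * rffFun W β z.1) - 1) ∂Pi =
        ∫ z, s * (max 0 (1 - z.2 * rffFun W β z.1) - 1) ∂Pi := by
      refine integral_congr_ae ?_
      filter_upwards [ae_label hPi] with z hz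
      rw [hclip _ hz]
    rw [hcongr, integral_const_mul, integral_sub
      (integrable_hinge hPi (measurable_rffFun W β) (abs_rffFun_le W (hTC β hβ)))
      (integrable_const _)]
    simp [hingeRisk]
  have hE : ∑ k, s * (max 0 (1 - clip (S k).2 * rffFun W β (S k).1) - 1) =
      s * (m * empHinge S (rffFun W β) - m) := by
    rw [← Finset.mul_sum, Finset.sum_sub_distrib, empHinge, ← mul_assoc, mul_one_div_cancel hm',
      one_mul]
    simp [hclip _ (hS _)]
  rw [hR, hE]
  field_simp
  ring

/-- The random coefficients `α(ω_j) / (D p(ω_j))` of the Monte Carlo approximation of a function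
with coefficients `α`. -/
noncomputable def sampledCoeff {K : ℕ} (p : Fin K → ℝ) (ab : (Fin K → ℝ) × (Fin K → ℝ))
    (W : Fin D → Fin K) : (Fin D → ℝ) × (Fin D → ℝ) :=
  (fun j => ab.1 (W j) / p (W j) / D, fun j => ab.2 (W j) / p (W j) / D)

lemma abs_div_le_of_abs_le_mul {a p C : ℝ} (hp : 0 ≤ p) (hC : 0 ≤ C) (h : |a| ≤ C * p) :
    |a / p| ≤ C := by
  rw [abs_div, abs_of_nonneg hp]
  exact div_le_of_le_mul₀ hp hC h

lemma inBox_sampledCoeff {K : ℕ} {p : Fin K → ℝ} (hp : ∀ i, 0 ≤ p i) {C : ℝ} (hC : 0 ≤ C)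
    {ab : (Fin K → ℝ) × (Fin K → ℝ)} (hab : ∀ i, |ab.1 i| ≤ C * p i ∧ |ab.2 i| ≤ C * p i)
    (W : Fin D → Fin K) : inBox C (sampledCoeff p ab W) := by
  intro j
  simp only [sampledCoeff]
  rw [abs_div, abs_div _ (D : ℝ), Nat.abs_cast]
  exact ⟨div_le_div_of_nonneg_right
      (abs_div_le_of_abs_le_mul (hp _) hC (hab _).1) (Nat.cast_nonneg _),
    div_le_div_of_nonneg_right
      (abs_div_le_of_abs_le_mul (hp _) hC (hab _).2) (Nat.cast_nonneg _)⟩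

/-- Monte Carlo approximation of the risk of a function with coefficients dominated by `C p`. -/
lemma measure_hingeRisk_sampledCoeff_le {K : ℕ} (hD : 0 < D)
    (ω : Fin K → EuclideanSpace ℝ (Fin d)) {p : Fin K → ℝ} (hp : ∀ i, 0 ≤ p i)
    {Pi : Measure (EuclideanSpace ℝ (Fin d) × ℝ)} [IsProbabilityMeasure Pi]
    (hPi : Pi {z | z.2 = 1 ∨ z.2 = -1} = 1) (ν : Measure (Fin K)) [IsProbabilityMeasure ν]
    (hν : ∀ i, ν {i} = ENNReal.ofReal (p i)) {C : ℝ} (hC : 0 < C)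
    {ab : (Fin K → ℝ) × (Fin K → ℝ)} (hab : ∀ i, |ab.1 i| ≤ C * p i ∧ |ab.2 i| ≤ C * p i)
    {t : ℝ} (ht : 0 ≤ t) :
    (Measure.pi fun _ : Fin D => ν)
      {W | t ≤ hingeRisk Pi (rffFun (fun j => ω (W j)) (sampledCoeff p ab W)) -
        hingeRisk Pi (fun x => ∑ i,
          (ab.1 i * Real.cos ⟪ω i, x⟫_ℝ + ab.2 i * Real.sin ⟪ω i, x⟫_ℝ))} ≤
      ENNReal.ofReal (2 * Real.exp (-(t ^ 2 * D / (8 * C ^ 2)))) := by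
  have hD' : (0 : ℝ) < D := Nat.cast_pos.2 hD
  set f : EuclideanSpace ℝ (Fin d) → ℝ := fun x => ∑ i,
    (ab.1 i * Real.cos ⟪ω i, x⟫_ℝ + ab.2 i * Real.sin ⟪ω i, x⟫_ℝ) with hf
  let h : Fin K → EuclideanSpace ℝ (Fin d) × ℝ → ℝ := fun i z =>
    ab.1 i / p i * Real.cos ⟪ω i, z.1⟫_ℝ + ab.2 i / p i * Real.sin ⟪ω i, z.1⟫_ℝ
  have hm : Measurable (Function.uncurry h) :=
    measurable_from_prod_countable_right fun i => by
      simp only [h, Function.uncurry]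
      fun_prop
  have hb : ∀ i z, |h i z| ≤ 2 * C := fun i z =>
    abs_mul_cos_add_mul_sin_le (abs_div_le_of_abs_le_mul (hp i) hC.le (hab i).1)
      (abs_div_le_of_abs_le_mul (hp i) hC.le (hab i).2) _
  have hmean : ∀ z, ∫ i, h i z ∂ν = f z.1 := by
    intro z
    rw [integral_fintype (Integrable.of_finite)]
    refine Finset.sum_congr rfl fun i _ => ?_
    rw [measureReal_def, hν i, ENNReal.toReal_ofReal (hp i), smul_eq_mul]
    rcases (hp i).eq_or_lt with h0 | h0
    · have h1 : ab.1 i = 0 := by simpa [← h0] using (hab i).1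
      have h2 : ab.2 i = 0 := by simpa [← h0] using (hab i).2
      simp [h, h1, h2]
    · simp only [h]
      field_simp
  have hfm : Measurable f := by fun_prop
  have hfb : ∀ x, |f x| ≤ 2 * C := fun x => by
    rw [← hmean (x, 0)]
    simpa using norm_integral_le_of_norm_le_const (μ := ν) (f := fun i => h i (x, 0))
      (ae_of_all _ fun i => hb i _)
  have hmain := measureReal_integral_abs_sum_sub_le (κ := Fin D) ν Pi h hm
    (by positivity : 0 < 2 * C) hb ht
  have h8 : 2 * (2 * C) ^ 2 = 8 * C ^ 2 := by ring
  simp only [Fintype.card_fin, hmean, h8] at hmain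
  refine le_trans (measure_mono ?_) (ENNReal.le_ofReal_iff_toReal_le (measure_ne_top _ _)
    (by positivity) |>.2 hmain)
  intro W hW
  have hle := le_trans hW (hingeRisk_sub_le hPi (measurable_rffFun _ _) hfm
    (abs_rffFun_le _ (inBox_sampledCoeff hp hC.le hab W)) hfb)
  have heq : ∀ z : EuclideanSpace ℝ (Fin d) × ℝ, |∑ k, (h (W k) z - f z.1)| =
      D * |rffFun (fun j => ω (W j)) (sampledCoeff p ab W) z.1 - f z.1| := by
    intro z
    have habs : ∀ x : ℝ, (D : ℝ) * |x| = |D * x| := fun x => by rw [abs_mul, abs_of_pos hD']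
    rw [habs]
    congr 1
    rw [Finset.sum_sub_distrib, mul_sub, rffFun, Finset.mul_sum]
    simp only [Finset.sum_const, Finset.card_univ, Fintype.card_fin, nsmul_eq_mul]
    congr 1
    refine Finset.sum_congr rfl fun j _ => ?_
    simp only [h, sampledCoeff]
    field_simp
  change (D : ℝ) * t ≤ _
  simp_rw [heq]
  rw [integral_const_mul]
  exact mul_le_mul_of_nonneg_left hle hD'.le

lemma exists_finset_net_rffFun (hD : 0 < D) {C : ℝ} (hC : 0 ≤ C) {ε : ℝ} (hε : 0 < ε) :
    ∃ T : Finset ((Fin D → ℝ) × (Fin D → ℝ)), T.Nonempty ∧ (∀ β ∈ T, inBox C β) ∧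
      ∀ β, inBox C β → ∃ β' ∈ T, ∀ (W : Fin D → EuclideanSpace ℝ (Fin d)) x,
        |rffFun W β x - rffFun W β' x| ≤ ε := by
  have hD' : (0 : ℝ) < D := Nat.cast_pos.2 hD
  obtain ⟨T, hT, hTC, hnet⟩ := exists_finset_net_inBox D hC
    (by positivity : 0 < ε / (2 * D))
  refine ⟨T, hT, hTC, fun β hβ => ?_⟩
  obtain ⟨β', hβ', h⟩ := hnet β hβ
  refine ⟨β', hβ', fun W x => ?_⟩
  rw [← rffFun_sub]
  refine (abs_rffFun_le W h x).trans (le_of_eq ?_)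
  field_simp

lemma sum_sq_le_of_inBox (hD : 0 < D) {C : ℝ} {β : (Fin D → ℝ) × (Fin D → ℝ)}
    (hβ : inBox C β) : ∑ j, (β.1 j ^ 2 + β.2 j ^ 2) ≤ 2 * C ^ 2 / D := by
  have hD' : (0 : ℝ) < D := Nat.cast_pos.2 hD
  calc _ ≤ ∑ _j : Fin D, 2 * (C / D) ^ 2 := by
        refine Finset.sum_le_sum fun j _ => ?_
        have h1 := sq_le_sq' (abs_le.1 (hβ j).1).1 (abs_le.1 (hβ j).1).2
        have h2 := sq_le_sq' (abs_le.1 (hβ j).2).1 (abs_le.1 (hβ j).2).2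
        linarith
    _ = _ := by
        simp only [Finset.sum_const, Finset.card_univ, Fintype.card_fin, nsmul_eq_mul]
        field_simp

/-- Excess risk of a regularized empirical minimizer, given uniform deviation bounds on a net. -/
lemma hingeRisk_le_of_empObj_le {m : ℕ} (hm : 0 < m) (hD : 0 < D)
    {Pi : Measure (EuclideanSpace ℝ (Fin d) × ℝ)} [IsProbabilityMeasure Pi]
    (hPi : Pi {z | z.2 = 1 ∨ z.2 = -1} = 1) (W : Fin D → EuclideanSpace ℝ (Fin d))
    {S : Fin m → EuclideanSpace ℝ (Fin d) × ℝ} (hS : ∀ i, (S i).2 = 1 ∨ (S i).2 = -1)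
    {C lam ε t : ℝ} (hlam : 0 ≤ lam) {T : Finset ((Fin D → ℝ) × (Fin D → ℝ))}
    (hTC : ∀ β ∈ T, inBox C β)
    (hnet : ∀ β, inBox C β → ∃ β' ∈ T, ∀ x, |rffFun W β x - rffFun W β' x| ≤ ε)
    (hT : ∀ β ∈ T, |hingeRisk Pi (rffFun W β) - empHinge S (rffFun W β)| ≤ t)
    {β γ : (Fin D → ℝ) × (Fin D → ℝ)} (hβ : inBox C β) (hγ : inBox C γ)
    (hle : empObj lam W S β ≤ empObj lam W S γ) :
    hingeRisk Pi (rffFun W β) ≤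
      hingeRisk Pi (rffFun W γ) + 2 * t + 4 * ε + lam * C ^ 2 / D := by
  have hrisk : ∀ β γ, inBox C β → inBox C γ → (∀ x, |rffFun W β x - rffFun W γ x| ≤ ε) →
      hingeRisk Pi (rffFun W β) - hingeRisk Pi (rffFun W γ) ≤ ε := by
    intro β γ hβ hγ h
    refine (hingeRisk_sub_le hPi (measurable_rffFun W β) (measurable_rffFun W γ)
      (abs_rffFun_le W hβ) (abs_rffFun_le W hγ)).trans ?_
    refine (le_abs_self _).trans ?_
    simpa using norm_integral_le_of_norm_le_const (μ := Pi)
      (f := fun z => |rffFun W β z.1 - rffFun W γ z.1|) (C := ε)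
      (ae_of_all _ fun z => by simpa using h z.1)
  obtain ⟨β', hβ', hββ'⟩ := hnet β hβ
  obtain ⟨γ', hγ', hγγ'⟩ := hnet γ hγ
  have hβ'β : ∀ x, |rffFun W β' x - rffFun W β x| ≤ ε := fun x => by
    rw [abs_sub_comm]; exact hββ' x
  have hγ'γ : ∀ x, |rffFun W γ' x - rffFun W γ x| ≤ ε := fun x => by
    rw [abs_sub_comm]; exact hγγ' x
  have h1 := hrisk β β' hβ (hTC _ hβ') hββ'
  have h2 := hrisk γ' γ (hTC _ hγ') hγ hγ'γ
  have h3 := empHinge_sub_le hm hS hβ'β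
  have h4 := empHinge_sub_le hm hS hγγ'
  have h5 := abs_le.1 (hT β' hβ')
  have h6 := abs_le.1 (hT γ' hγ')
  have h7 : lam / 2 * ∑ j, (β.1 j ^ 2 + β.2 j ^ 2) + empHinge S (rffFun W β) ≤
      lam / 2 * ∑ j, (γ.1 j ^ 2 + γ.2 j ^ 2) + empHinge S (rffFun W γ) := hle
  have h8 : 0 ≤ lam / 2 * ∑ j, (β.1 j ^ 2 + β.2 j ^ 2) := by positivity
  have h9 : lam / 2 * ∑ j, (γ.1 j ^ 2 + γ.2 j ^ 2) ≤ lam / 2 * (2 * C ^ 2 / D) :=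
    mul_le_mul_of_nonneg_left (sum_sq_le_of_inBox hD hγ) (by positivity)
  have h10 : lam / 2 * (2 * C ^ 2 / D) = lam * C ^ 2 / D := by ring
  linarith [h5.1, h5.2, h6.1, h6.2]

end RandomFeatures

lemma measure_prod_setOf_le {α β : Type*} [MeasurableSpace α] [MeasurableSpace β] [Fintype β]
    [MeasurableSingletonClass β] (μ : Measure α) (ν : Measure β) [SFinite μ]
    [IsProbabilityMeasure ν] {c : ENNReal} (A : β → Set α) (hA : ∀ b, μ (A b) ≤ c) :
    (μ.prod ν) {x | x.1 ∈ A x.2} ≤ c := by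
  have hsub : {x : α × β | x.1 ∈ A x.2} ⊆ ⋃ b, A b ×ˢ {b} := fun x hx =>
    Set.mem_iUnion.2 ⟨x.2, hx, rfl⟩
  calc _ ≤ ∑ b, (μ.prod ν) (A b ×ˢ {b}) :=
        (measure_mono hsub).trans (measure_iUnion_fintype_le _ _)
    _ ≤ ∑ b, c * ν {b} := Finset.sum_le_sum fun b _ => by
        rw [Measure.prod_prod]
        gcongr
        exact hA b
    _ = c := by
        rw [← Finset.mul_sum, sum_measure_singleton, Finset.coe_univ, measure_univ, mul_one]

lemma two_mul_exp_neg_le {δ u : ℝ} (hδ : 0 < δ) (hδ2 : δ ≤ 1 / 2)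
    (hu : 3 * Real.log (1 / δ) ≤ u) : 2 * Real.exp (-u) ≤ 2 * δ / 3 := by
  have h1 : Real.exp (-u) ≤ δ ^ 3 := by
    rw [← Real.exp_log (pow_pos hδ 3), Real.log_pow]
    rw [one_div, Real.log_inv] at hu
    exact Real.exp_le_exp.2 (by push_cast; linarith)
  have h2 : δ ^ 2 ≤ (1 / 2) ^ 2 := pow_le_pow_left₀ hδ.le hδ2 2
  have h3 : δ ^ 3 ≤ δ / 4 := by nlinarith
  linarith

lemma half_le_sqrt_log_one_div {δ : ℝ} (hδ : 0 < δ) (hδ2 : δ ≤ 1 / 2) :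
    1 / 2 ≤ Real.sqrt (Real.log (1 / δ)) := by
  refine Real.le_sqrt_of_sq_le ?_
  have h1 : Real.log 2 ≤ Real.log (1 / δ) :=
    Real.log_le_log two_pos (by rw [le_div_iff₀ hδ]; linarith)
  linarith [Real.log_two_gt_d9]

/-- **Performance guarantee of the RFF-SVM algorithm.**  There is a universal constant
`κ > 0` such that for any finite frequency set `ω : Fin K → ℝ^d` with sampling pmf `p`,
any data distribution `Π` on `ℝ^d × {−1,1}`, training size `m`, feature count `D`,
search radius `C > 0`, regularization `λ ≥ 0` and `δ ∈ (0,1)`: with probability at least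
`1 − 2δ` over the i.i.d. training data and frequency samples, any empirical minimizer
`β̂` over the box `‖β‖_∞ ≤ C/D` satisfies
`R[f̂] − min_{f ∈ 𝒢_{p,C}} R[f] ≤ κ((1/√m + 1/√D) C √log(1/δ) + λC²/D)`. -/
theorem rff_svm_generalization :
    ∃ κ : ℝ, 0 < κ ∧
      ∀ (d K : ℕ) (ω : Fin K → EuclideanSpace ℝ (Fin d)) (p : Fin K → ℝ),
        (∀ i, 0 ≤ p i) → (∑ i, p i) = 1 →
        ∀ (Pi : Measure (EuclideanSpace ℝ (Fin d) × ℝ)) [IsProbabilityMeasure Pi],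
        Pi {z | z.2 = 1 ∨ z.2 = -1} = 1 →
        ∀ (ν : Measure (Fin K)) [IsProbabilityMeasure ν],
        (∀ i, ν {i} = ENNReal.ofReal (p i)) →
        ∀ (m D : ℕ), 0 < m → 0 < D →
        ∀ C lam δ : ℝ, 0 < C → 0 ≤ lam → 0 < δ → δ < 1 →
        ENNReal.ofReal (1 - 2 * δ) ≤
          ((Measure.pi fun _ : Fin m => Pi).prod (Measure.pi fun _ : Fin D => ν))
            {SW : (Fin m → EuclideanSpace ℝ (Fin d) × ℝ) × (Fin D → Fin K) |
              ∀ β : (Fin D → ℝ) × (Fin D → ℝ),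
                inBox C β →
                (∀ β' : (Fin D → ℝ) × (Fin D → ℝ), inBox C β' →
                  empObj lam (fun j => ω (SW.2 j)) SW.1 β ≤
                    empObj lam (fun j => ω (SW.2 j)) SW.1 β') →
                hingeRisk Pi (rffFun (fun j => ω (SW.2 j)) β) -
                    (⨅ ab : {ab : (Fin K → ℝ) × (Fin K → ℝ) //
                        ∀ i, |ab.1 i| ≤ C * p i ∧ |ab.2 i| ≤ C * p i},
                      hingeRisk Pi (fun x => ∑ i,
                        (ab.1.1 i * Real.cos ⟪ω i, x⟫_ℝ +
                          ab.1.2 i * Real.sin ⟪ω i, x⟫_ℝ))) ≤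
                  κ * ((1 / Real.sqrt m + 1 / Real.sqrt D) * C *
                      Real.sqrt (Real.log (1 / δ)) +
                    lam * C ^ 2 / D) } := by
  refine ⟨28, by norm_num, ?_⟩
  intro d K ω p hp hp1 Pi _ hPi ν _ hν m D hm hD C lam δ hC hlam hδ hδ1
  rcases lt_or_ge (1 / 2) δ with hδ2 | hδ2
  · rw [ENNReal.ofReal_of_nonpos (by linarith)]
    exact zero_le
  have hm' : (0 : ℝ) < m := Nat.cast_pos.2 hm
  have hD' : (0 : ℝ) < D := Nat.cast_pos.2 hD
  have hsm := Real.sqrt_pos.2 hm'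
  have hsD := Real.sqrt_pos.2 hD'
  have hlog : 0 ≤ Real.log (1 / δ) := Real.log_nonneg (by rw [le_div_iff₀ hδ]; linarith)
  have hL := half_le_sqrt_log_one_div hδ hδ2
  have hLsq := Real.sq_sqrt hlog
  set L := Real.sqrt (Real.log (1 / δ))
  set inf := ⨅ ab : {ab : (Fin K → ℝ) × (Fin K → ℝ) //
      ∀ i, |ab.1 i| ≤ C * p i ∧ |ab.2 i| ≤ C * p i},
    hingeRisk Pi (fun x => ∑ i, (ab.1.1 i * Real.cos ⟪ω i, x⟫_ℝ +
      ab.1.2 i * Real.sin ⟪ω i, x⟫_ℝ))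
  have : Nonempty {ab : (Fin K → ℝ) × (Fin K → ℝ) //
      ∀ i, |ab.1 i| ≤ C * p i ∧ |ab.2 i| ≤ C * p i} :=
    ⟨⟨0, fun i => by simpa using mul_nonneg hC.le (hp i)⟩⟩
  obtain ⟨⟨ab, hab⟩, hlt⟩ := exists_lt_of_ciInf_lt
    (show inf < inf + C / Real.sqrt D by linarith [div_pos hC hsD])
  obtain ⟨T, hT, hTC, hnet⟩ := exists_finset_net_rffFun (d := d) hD hC.le (div_pos hC hsm)
  set t := 10 * C * L / Real.sqrt m with ht
  set u := 5 * C * L / Real.sqrt D with hu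
  have ht0 : 0 ≤ t := by positivity
  have hu0 : 0 ≤ u := by positivity
  have htexp : 3 * Real.log (1 / δ) ≤ t ^ 2 * m / (32 * C ^ 2) := by
    rw [ht, div_pow, Real.sq_sqrt hm'.le, div_mul_cancel₀ _ hm'.ne', mul_pow, hLsq,
      le_div_iff₀ (by positivity)]
    nlinarith [mul_nonneg hlog (sq_nonneg C)]
  have huexp : 3 * Real.log (1 / δ) ≤ u ^ 2 * D / (8 * C ^ 2) := by
    rw [hu, div_pow, Real.sq_sqrt hD'.le, div_mul_cancel₀ _ hD'.ne', mul_pow, hLsq,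
      le_div_iff₀ (by positivity)]
    nlinarith [mul_nonneg hlog (sq_nonneg C)]
  set P := Measure.pi fun _ : Fin m => Pi
  set Q := Measure.pi fun _ : Fin D => ν
  let dev : ℝ → (Fin D → Fin K) → Set (Fin m → EuclideanSpace ℝ (Fin d) × ℝ) := fun s W =>
    {S | ∃ β ∈ T, t ≤ s * (hingeRisk Pi (rffFun (fun j => ω (W j)) β) -
      empHinge S (rffFun (fun j => ω (W j)) β))}
  let far : Set (Fin D → Fin K) :=
    {W | u ≤ hingeRisk Pi (rffFun (fun j => ω (W j)) (sampledCoeff p ab W)) -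
      hingeRisk Pi (fun x => ∑ i,
        (ab.1 i * Real.cos ⟪ω i, x⟫_ℝ + ab.2 i * Real.sin ⟪ω i, x⟫_ℝ))}
  let bad : Set (Fin m → EuclideanSpace ℝ (Fin d) × ℝ) :=
    {S | ¬ ∀ i, (S i).2 = 1 ∨ (S i).2 = -1}
  have hdev : ∀ s : ℝ, |s| = 1 →
      (P.prod Q) {SW | SW.1 ∈ dev s SW.2} ≤ ENNReal.ofReal (2 * δ / 3) := fun s hs =>
    measure_prod_setOf_le P Q (dev s) fun W =>
      (measure_exists_hingeRisk_deviation_le hm hD hPi _ hC hT hTC hs ht0).trans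
        (ENNReal.ofReal_le_ofReal (two_mul_exp_neg_le hδ hδ2 htexp))
  have hfar : (P.prod Q) (Set.univ ×ˢ far) ≤ ENNReal.ofReal (2 * δ / 3) := by
    rw [Measure.prod_prod, measure_univ, one_mul]
    exact (measure_hingeRisk_sampledCoeff_le hD ω hp hPi ν hν hC hab hu0).trans
      (ENNReal.ofReal_le_ofReal (two_mul_exp_neg_le hδ hδ2 huexp))
  have hbad : (P.prod Q) (bad ×ˢ Set.univ) = 0 := by
    rw [Measure.prod_prod, show P bad = 0 from ae_pi_label hPi, zero_mul]
  have hexc : (P.prod Q) ({SW | SW.1 ∈ dev 1 SW.2} ∪ {SW | SW.1 ∈ dev (-1) SW.2} ∪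
      Set.univ ×ˢ far ∪ bad ×ˢ Set.univ) ≤ ENNReal.ofReal (2 * δ) := by
    calc _ ≤ ENNReal.ofReal (2 * δ / 3) + ENNReal.ofReal (2 * δ / 3) +
          ENNReal.ofReal (2 * δ / 3) + 0 :=
          (measure_union_le _ _).trans (add_le_add ((measure_union_le _ _).trans (add_le_add
            ((measure_union_le _ _).trans (add_le_add (hdev 1 (by simp)) (hdev (-1) (by simp))))
            hfar)) hbad.le)
      _ = ENNReal.ofReal (2 * δ) := by
          rw [add_zero, ← ENNReal.ofReal_add (by positivity) (by positivity),
            ← ENNReal.ofReal_add (by positivity) (by positivity)]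
          congr 1
          ring
  rw [ENNReal.ofReal_sub _ (by positivity), ENNReal.ofReal_one, tsub_le_iff_right]
  refine le_trans ?_ (add_le_add_right hexc _)
  refine le_trans ?_ (measure_union_le _ _)
  rw [← measure_univ (μ := P.prod Q)]
  refine measure_mono ?_
  rintro ⟨S, W⟩ -
  by_contra hcon
  simp only [Set.mem_union, not_or, Set.mem_prod, Set.mem_univ, true_and, and_true,
    Set.mem_ofPred_eq] at hcon
  obtain ⟨hgood, ⟨⟨h1, h2⟩, h3⟩, h4⟩ := hcon
  refine hgood fun β hβ hmin => ?_
  have hS : ∀ i, (S i).2 = 1 ∨ (S i).2 = -1 := not_not.1 h4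
  have hTdev : ∀ β ∈ T, |hingeRisk Pi (rffFun (fun j => ω (W j)) β) -
      empHinge S (rffFun (fun j => ω (W j)) β)| ≤ t := by
    intro β hβ
    have h5 := lt_of_not_ge fun h => h1 ⟨β, hβ, h⟩
    have h6 := lt_of_not_ge fun h => h2 ⟨β, hβ, h⟩
    exact abs_le.2 ⟨by linarith, by linarith⟩
  have hγ := inBox_sampledCoeff hp hC.le hab W
  have hchain := hingeRisk_le_of_empObj_le hm hD hPi (fun j => ω (W j)) hS hlam hTC
    (fun β hβ => (hnet β hβ).imp fun _ h => ⟨h.1, h.2 _⟩) hTdev hβ hγ (hmin _ hγ)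
  have h7 := not_le.1 (show ¬u ≤ _ from h3)
  have h8 : C / Real.sqrt m ≤ 2 * (C * L / Real.sqrt m) := by
    rw [← mul_div_assoc]
    gcongr
    nlinarith
  have h9 : C / Real.sqrt D ≤ 2 * (C * L / Real.sqrt D) := by
    rw [← mul_div_assoc]
    gcongr
    nlinarith
  have h10 : 28 * ((1 / Real.sqrt m + 1 / Real.sqrt D) * C * L + lam * C ^ 2 / D) =
      28 * (C * L / Real.sqrt m) + 28 * (C * L / Real.sqrt D) + 28 * (lam * C ^ 2 / D) := by
    ring
  have ht' : t = 10 * (C * L / Real.sqrt m) := by rw [ht]; ring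
  have hu' : u = 5 * (C * L / Real.sqrt D) := by rw [hu]; ring
  have h11 : 0 ≤ lam * C ^ 2 / D := by positivity
  have h12 : 0 ≤ C * L / Real.sqrt D := by positivity
  rw [h10]
  linarith
end
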